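/- Let d ≥ 3. There exists u > 0 such that for every vacant-set law Q at level u, the Q-probability that the origin 0 belongs to an infinite nearest-neighbor connected component of {x ∈ ℤ^d : Y_x = 1} is strictly positive. In particular the critical level u_* = inf{u ≥ 0 : Q_u[0 lies in an infinite component of {Y = 1}] = 0} of random interlacements is strictly positive in all dimensions d ≥ 3. -/

import Mathlib

open MeasureTheory Filter

namespace RI

/-- Points of `ℤ^d`. -/
abbrev Zd (d : ℕ) := Fin d → ℤ

/-- `x` and `y` are nearest neighbours: `|x - y| = 1`. -/
def adj {d : ℕ} (x y : Zd d) : Prop := (∑ i, |x i - y i|) = 1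

/-- `x` and `y` are `*`-neighbours: `|x - y|_∞ = 1`. -/
def starAdj {d : ℕ} (x y : Zd d) : Prop := x ≠ y ∧ ∀ i, |x i - y i| ≤ 1

/-- `x` belongs to the plane `ℤ e₁ + ℤ e₂ ⊆ ℤ^d`. -/
def inPlane {d : ℕ} (x : Zd d) : Prop := ∀ i : Fin d, 2 ≤ (i : ℕ) → x i = 0

/-- The `k`-th coordinate of `x`, with value `0` for out-of-range indices. -/
def coord {d : ℕ} (x : Zd d) (k : ℕ) : ℤ := if h : k < d then x ⟨k, h⟩ else 0

/-- `P` is the family of laws of the simple random walks on `ℤ^d` started at the points of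
`ℤ^d`: each `P x` is a probability measure on the path space `ℕ → ℤ^d`, and the cylinder
probabilities are those of the walk with i.i.d. increments uniform on `{± e_i}`. -/
def IsSRW (d : ℕ) (P : Zd d → Measure (ℕ → Zd d)) : Prop :=
  (∀ x, IsProbabilityMeasure (P x)) ∧
  (∀ (x : Zd d) (n : ℕ) (w : ℕ → Zd d),
      (w 0 = x ∧ ∀ k < n, adj (w k) (w (k + 1))) →
        P x {ω | ∀ k ≤ n, ω k = w k} = ((2 * d : ENNReal))⁻¹ ^ n) ∧
  (∀ (x : Zd d) (n : ℕ) (w : ℕ → Zd d),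
      ¬(w 0 = x ∧ ∀ k < n, adj (w k) (w (k + 1))) →
        P x {ω | ∀ k ≤ n, ω k = w k} = 0)

/-- The equilibrium measure of a set `V ⊆ ℤ^d`:
`e_V(x) = P_x[H̃_V = ∞]` for `x ∈ V`, and `0` otherwise. -/
noncomputable def eqm {d : ℕ} (P : Zd d → Measure (ℕ → Zd d)) (V : Set (Zd d)) : Zd d → ℝ :=
  V.indicator fun x => (P x {ω | ∀ n, 1 ≤ n → ω n ∉ V}).toReal

/-- The capacity of a finite set `K ⊆ ℤ^d`. -/
noncomputable def capa {d : ℕ} (P : Zd d → Measure (ℕ → Zd d)) (K : Finset (Zd d)) : ℝ :=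
  ∑ x ∈ K, eqm P (↑K) x

/-- `Q` is a vacant-set law at level `u`: a probability measure on `{0,1}^{ℤ^d}`
(with `true = 1` standing for "vacant") such that
`Q[Y_x = 1 ∀ x ∈ K] = exp(-u cap K)` for every finite `K`. -/
def IsVacantLaw {d : ℕ} (P : Zd d → Measure (ℕ → Zd d)) (u : ℝ)
    (Q : Measure (Zd d → Bool)) : Prop :=
  IsProbabilityMeasure Q ∧
  ∀ K : Finset (Zd d),
    Q {Y | ∀ x ∈ K, Y x = true} = ENNReal.ofReal (Real.exp (-(u * capa P K)))

/-- There is a `*`-path starting in `S`, ending in `T`, all of whose points lie in `A`. -/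
def HasStarPath {d : ℕ} (S T A : Set (Zd d)) : Prop :=
  ∃ (N : ℕ) (w : ℕ → Zd d), w 0 ∈ S ∧ w N ∈ T ∧ (∀ k ≤ N, w k ∈ A) ∧
    ∀ k < N, starAdj (w k) (w (k + 1))

/-- Interior boundary `∂_int U`. -/
def intBdry {d : ℕ} (U : Set (Zd d)) : Set (Zd d) := {x | x ∈ U ∧ ∃ y, y ∉ U ∧ adj x y}

/-- (Exterior) boundary `∂U`. -/
def bdry {d : ℕ} (U : Set (Zd d)) : Set (Zd d) := {x | x ∉ U ∧ ∃ y ∈ U, adj x y}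

/-- `ℓ = 100 ⌊L^{1/100}⌋ + 1`. -/
noncomputable def ellOf (L : ℕ) : ℕ := 100 * ⌊(L : ℝ) ^ ((1 : ℝ) / 100)⌋₊ + 1

/-- The scales `L_{n+1} = ℓ_n L_n`. -/
noncomputable def Lseq (L0 : ℕ) : ℕ → ℕ
  | 0 => L0
  | n + 1 => ellOf (Lseq L0 n) * Lseq L0 n

/-- The levels `u_{n+1} = (1 + 1/log L_n)⁻¹ u_n`. -/
noncomputable def useq (L0 : ℕ) (u0 : ℝ) : ℕ → ℝ
  | 0 => u0
  | n + 1 => (1 + 1 / Real.log (Lseq L0 n))⁻¹ * useq L0 u0 n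

/-- The event (on the configuration space `{0,1}^{ℤ^d}`) that there is a `*`-path from
`[-L,L]² ∩ ℤ²` to `∂_int ([-3L,3L]^d ∩ ℤ^d)` all of whose points lie in `{x ∈ ℤ² : Y_x = 0}`. -/
def qEvent (d : ℕ) (L : ℕ) : Set (Zd d → Bool) :=
  {Y | HasStarPath
    {x : Zd d | inPlane x ∧ ∀ i, |x i| ≤ (L : ℤ)}
    (intBdry {x : Zd d | ∀ i, |x i| ≤ (3 * L : ℤ)})
    {x : Zd d | inPlane x ∧ Y x = false}}


/-- The nearest-neighbour connected component of `x` inside `S`. -/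
def component {d : ℕ} (S : Set (Zd d)) (x : Zd d) : Set (Zd d) :=
  {y | Relation.ReflTransGen (fun a b => adj a b ∧ a ∈ S ∧ b ∈ S) x y}

end RI

namespace RI

variable {d : ℕ}

/-- The `2 * d` unit steps of the walk. -/
def unitStep (s : Fin d × Bool) : Zd d := Pi.single s.1 (if s.2 then 1 else -1)

/-- The average of `φ` over the neighbours of `x`. -/
noncomputable def avg (φ : Zd d → ENNReal) (x : Zd d) : ENNReal :=
  (2 * d : ENNReal)⁻¹ * ∑ s : Fin d × Bool, φ (x + unitStep s)

/-- The time shift on paths. -/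
def shift (ω : ℕ → Zd d) : ℕ → Zd d := fun n => ω (n + 1)

lemma unitStep_injective : Function.Injective (unitStep : Fin d × Bool → Zd d) := by
  rintro ⟨i, b⟩ ⟨j, c⟩ h
  have h1 := congrFun h i
  have hij : i = j := by
    by_contra hne
    simp only [unitStep, Pi.single_eq_same, Pi.single_eq_of_ne hne] at h1
    split_ifs at h1
    simp at h1
  subst hij
  simp only [unitStep, Pi.single_eq_same] at h1
  cases b <;> cases c <;> simp_all

lemma neg_unitStep (i : Fin d) (b : Bool) : -unitStep (i, b) = unitStep (i, !b) := by
  ext j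
  by_cases h : j = i
  · subst h; cases b <;> simp [unitStep]
  · simp [unitStep, Pi.single_eq_of_ne h]

lemma adj_iff_exists_unitStep {x y : Zd d} : adj x y ↔ ∃ s, y = x + unitStep s := by
  constructor
  · intro h
    unfold adj at h
    have hex : ∃ i, x i - y i ≠ 0 := by
      by_contra! hc
      simp [hc] at h
    obtain ⟨i, hi⟩ := hex
    have hsum := Finset.add_sum_erase Finset.univ (fun i => |x i - y i|) (Finset.mem_univ i)
    rw [h] at hsum
    have h1 : 1 ≤ |x i - y i| := Int.one_le_abs hi
    have h2 : 0 ≤ ∑ j ∈ Finset.univ.erase i, |x j - y j| :=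
      Finset.sum_nonneg fun _ _ => abs_nonneg _
    have h3 : ∑ j ∈ Finset.univ.erase i, |x j - y j| = 0 := by linarith
    have h4 : |x i - y i| = 1 := by linarith
    rw [Finset.sum_eq_zero_iff_of_nonneg fun _ _ => abs_nonneg _] at h3
    have h5 : ∀ j, j ≠ i → y j = x j := fun j hj => by
      have := h3 j (Finset.mem_erase.2 ⟨hj, Finset.mem_univ j⟩)
      rw [abs_eq_zero] at this
      linarith
    rcases (abs_eq zero_le_one).1 h4 with h6 | h6
    · refine ⟨(i, false), funext fun j => ?_⟩
      by_cases hj : j = i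
      · subst hj; simp [unitStep]; linarith
      · simp [unitStep, Pi.single_eq_of_ne hj, h5 j hj]
    · refine ⟨(i, true), funext fun j => ?_⟩
      by_cases hj : j = i
      · subst hj; simp [unitStep]; linarith
      · simp [unitStep, Pi.single_eq_of_ne hj, h5 j hj]
  · rintro ⟨⟨i, b⟩, rfl⟩
    unfold adj
    rw [Finset.sum_eq_single i]
    · cases b <;> simp [unitStep]
    · intro j _ hj
      simp [unitStep, Pi.single_eq_of_ne hj]
    · simp

lemma measurable_shift : Measurable (shift : (ℕ → Zd d) → (ℕ → Zd d)) :=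
  measurable_pi_lambda _ fun n => measurable_pi_apply (n + 1)

lemma measurableSet_eval (n : ℕ) (A : Set (Zd d)) : MeasurableSet {ω : ℕ → Zd d | ω n ∈ A} :=
  measurable_pi_apply n (MeasurableSet.of_discrete : MeasurableSet A)

/-- The path cylinders. -/
def cylinders (d : ℕ) : Set (Set (ℕ → Zd d)) :=
  {B | ∃ (n : ℕ) (w : ℕ → Zd d), B = {ω | ∀ k ≤ n, ω k = w k}}

lemma isPiSystem_cylinders : IsPiSystem (cylinders d) := by
  rintro _ ⟨n, w, rfl⟩ _ ⟨m, v, rfl⟩ ⟨η, h1, h2⟩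
  simp only [Set.mem_ofPred_eq] at h1 h2
  refine ⟨max n m, η, ?_⟩
  ext ω
  simp only [Set.mem_inter_iff, Set.mem_ofPred_eq]
  constructor
  · rintro ⟨h3, h4⟩ k hk
    rcases le_max_iff.1 hk with hk | hk
    · rw [h3 k hk, h1 k hk]
    · rw [h4 k hk, h2 k hk]
  · intro h
    exact ⟨fun k hk => by rw [h k (le_max_of_le_left hk), h1 k hk],
      fun k hk => by rw [h k (le_max_of_le_right hk), h2 k hk]⟩

lemma generateFrom_cylinders :
    (MeasurableSpace.pi : MeasurableSpace (ℕ → Zd d)) =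
      MeasurableSpace.generateFrom (cylinders d) := by
  apply le_antisymm
  · refine iSup_le fun n => ?_
    rintro _ ⟨A, -, rfl⟩
    have : (fun ω : ℕ → Zd d => ω n) ⁻¹' A =
        ⋃ v : {v : Fin (n + 1) → Zd d // v (Fin.last n) ∈ A},
          {ω | ∀ k ≤ n, ω k = (fun j => if h : j < n + 1 then v.1 ⟨j, h⟩ else 0) k} := by
      ext ω
      simp only [Set.mem_preimage, Set.mem_iUnion, Set.mem_ofPred_eq]
      constructor
      · intro h
        refine ⟨⟨fun j => ω j, by simpa using h⟩, fun k hk => ?_⟩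
        simp [Nat.lt_succ_of_le hk]
      · rintro ⟨v, hv⟩
        rw [hv n le_rfl]
        simp only [Nat.lt_succ_self, dite_true]
        exact v.2
    rw [this]
    exact @MeasurableSet.iUnion _ _ (_) _ _ fun v =>
      MeasurableSpace.measurableSet_generateFrom ⟨n, _, rfl⟩
  · refine MeasurableSpace.generateFrom_le ?_
    rintro _ ⟨n, w, rfl⟩
    have : {ω : ℕ → Zd d | ∀ k ≤ n, ω k = w k} = ⋂ k ∈ Set.Iic n, {ω | ω k ∈ ({w k} : Set (Zd d))} := by
      ext; simp
    rw [this]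
    exact MeasurableSet.biInter (Set.to_countable _) fun k _ => measurableSet_eval k _

section Walk

variable {P : Zd d → Measure (ℕ → Zd d)}

lemma IsSRW.ae_start (hP : IsSRW d P) (x : Zd d) : ∀ᵐ ω ∂P x, ω 0 = x := by
  have := hP.1 x
  have h := hP.2.1 x 0 (fun _ => x) ⟨rfl, by simp⟩
  simp only [pow_zero, nonpos_iff_eq_zero, forall_eq] at h
  exact (prob_compl_eq_zero_iff (measurableSet_eval 0 {x})).2 h

lemma avg_const (hd : 0 < d) (c : ENNReal) (x : Zd d) : avg (fun _ => c) x = c := by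
  have h0 : (2 * d : ENNReal) ≠ 0 := by simp; omega
  have ht : (2 * d : ENNReal) ≠ ⊤ := ENNReal.mul_ne_top (by simp) (by simp)
  simp only [avg, Finset.sum_const, Finset.card_univ, Fintype.card_prod, Fintype.card_fin,
    Fintype.card_bool, nsmul_eq_mul, Nat.cast_mul, Nat.cast_ofNat]
  rw [← mul_assoc, mul_comm (d : ENNReal), ENNReal.inv_mul_cancel h0 ht, one_mul]

/-- The Markov property at time one. -/
theorem IsSRW.first_step (hd : 0 < d) (hP : IsSRW d P) (x : Zd d) {B : Set (ℕ → Zd d)}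
    (hB : MeasurableSet B) : P x (shift ⁻¹' B) = avg (fun y => P y B) x := by
  have hprob := hP.1
  have key : (P x).map shift = (2 * d : ENNReal)⁻¹ • ∑ s, P (x + unitStep s) := by
    refine ext_of_generate_finite (cylinders d) generateFrom_cylinders isPiSystem_cylinders ?_ ?_
    · rintro _ ⟨n, w, rfl⟩
      have hmeas : MeasurableSet {ω : ℕ → Zd d | ∀ k ≤ n, ω k = w k} := by
        rw [generateFrom_cylinders]
        exact MeasurableSpace.measurableSet_generateFrom ⟨n, w, rfl⟩
      rw [Measure.map_apply measurable_shift hmeas]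
      let w' : ℕ → Zd d := fun k => Nat.casesOn k x w
      have hcyl : P x (shift ⁻¹' {ω : ℕ → Zd d | ∀ k ≤ n, ω k = w k}) =
          P x {ω | ∀ k ≤ n + 1, ω k = w' k} := by
        refine measure_congr ?_
        filter_upwards [hP.ae_start x] with ω hω
        refine propext ⟨fun h k hk => ?_, fun h k hk => h (k + 1) (by omega)⟩
        cases k with
        | zero => exact hω
        | succ k => exact h k (by omega)
      rw [hcyl]
      simp only [Measure.smul_apply, Measure.finsetSum_apply, smul_eq_mul]
      by_cases hw : ∀ k < n, adj (w k) (w (k + 1))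
      · by_cases ha : adj x (w 0)
        · rw [hP.2.1 x (n + 1) w' ⟨rfl, fun k hk => by
            cases k with
            | zero => exact ha
            | succ k => exact hw k (by omega)⟩]
          obtain ⟨s, hs⟩ := adj_iff_exists_unitStep.1 ha
          rw [Finset.sum_eq_single s, hP.2.1 _ n w ⟨hs, hw⟩, pow_succ']
          · intro t _ hts
            refine hP.2.2 _ n w fun h => hts ?_
            exact unitStep_injective (add_left_cancel (h.1.symm.trans hs))
          · simp
        · rw [hP.2.2 x (n + 1) w' fun h => ha (h.2 0 (by omega)), Finset.sum_eq_zero, mul_zero]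
          exact fun s _ => hP.2.2 _ n w fun h => ha (adj_iff_exists_unitStep.2 ⟨s, h.1⟩)
      · rw [hP.2.2 x (n + 1) w' fun h => hw fun k hk => h.2 (k + 1) (by omega),
          Finset.sum_eq_zero, mul_zero]
        exact fun s _ => hP.2.2 _ n w fun h => hw h.2
    · rw [Measure.map_apply measurable_shift MeasurableSet.univ]
      have := avg_const hd 1 x
      simpa [avg, Measure.finsetSum_apply] using this.symm
  rw [← Measure.map_apply measurable_shift hB, key]
  simp [avg, Measure.finsetSum_apply]

end Walk

lemma avg_mono {f g : Zd d → ENNReal} (h : ∀ x, f x ≤ g x) (x : Zd d) : avg f x ≤ avg g x := by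
  unfold avg
  gcongr
  exact h _

lemma avg_const_mul (a : ENNReal) (f : Zd d → ENNReal) (x : Zd d) :
    avg (fun y => a * f y) x = a * avg f x := by
  simp only [avg, ← Finset.mul_sum]
  ring

lemma avg_finset_sum {ι : Type*} (S : Finset ι) (f : ι → Zd d → ENNReal) (x : Zd d) :
    avg (fun y => ∑ i ∈ S, f i y) x = ∑ i ∈ S, avg (f i) x := by
  simp only [avg, ← Finset.mul_sum]
  rw [Finset.sum_comm]

lemma avg_translate (f : Zd d → ENNReal) (y x : Zd d) :
    avg (fun z => f (z - y)) x = avg f (x - y) := by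
  simp only [avg, add_sub_right_comm]

section Walk

variable {P : Zd d → Measure (ℕ → Zd d)}

lemma iterate_shift_apply (n k : ℕ) (ω : ℕ → Zd d) : shift^[n] ω k = ω (k + n) := by
  induction n generalizing ω with
  | zero => rfl
  | succ n ih => rw [Function.iterate_succ_apply, ih]; rfl

lemma measurable_iterate_shift (n : ℕ) :
    Measurable (shift^[n] : (ℕ → Zd d) → (ℕ → Zd d)) := measurable_shift.iterate n

/-- A superharmonic function that is at least `1` on `D` dominates the probability of hitting
`D` and then realizing an event of conditional probability at most `a`. -/
theorem IsSRW.measure_hit_and_shift_le (hd : 0 < d) (hP : IsSRW d P) {D : Set (Zd d)}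
    {B : Set (ℕ → Zd d)} (hB : MeasurableSet B) (hBs : ∀ ω, shift ω ∈ B → ω ∈ B)
    {a : ENNReal} (ha : ∀ y ∈ D, P y B ≤ a) {f : Zd d → ENNReal} (hf : ∀ x, avg f x ≤ f x)
    (hfD : ∀ x ∈ D, 1 ≤ f x) (x : Zd d) :
    P x {ω | ∃ n, ω n ∈ D ∧ shift^[n] ω ∈ B} ≤ a * f x := by
  let E : ℕ → Set (ℕ → Zd d) := fun N => {ω | ∃ n < N, ω n ∈ D ∧ shift^[n] ω ∈ B}
  have hE : ∀ N, MeasurableSet (E N) := fun N => by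
    have : E N = ⋃ n ∈ Set.Iio N, ({ω | ω n ∈ D} ∩ shift^[n] ⁻¹' B) := by
      ext ω
      simp only [E, Set.mem_ofPred_eq, Set.mem_iUnion, Set.mem_Iio, Set.mem_inter_iff,
        Set.mem_preimage, exists_prop]
    rw [this]
    exact MeasurableSet.biUnion (Set.to_countable _) fun n _ =>
      (measurableSet_eval n D).inter (measurable_iterate_shift n hB)
  have hBit : ∀ n ω, shift^[n] ω ∈ B → ω ∈ B := fun n => by
    induction n with
    | zero => exact fun ω h => h
    | succ n ih => exact fun ω h => hBs ω (ih _ h)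
  have hmain : ∀ N x, P x (E N) ≤ a * f x := by
    intro N
    induction N with
    | zero => intro x; simp [E]
    | succ N ih =>
      intro x
      by_cases hx : x ∈ D
      · calc P x (E (N + 1)) ≤ P x B := measure_mono fun ω ⟨n, _, _, h⟩ => hBit n ω h
          _ ≤ a := ha x hx
          _ ≤ a * f x := le_mul_of_one_le_right' (hfD x hx)
      · calc P x (E (N + 1)) ≤ P x (shift ⁻¹' E N) := by
              refine measure_mono_ae ?_
              filter_upwards [hP.ae_start x] with ω hω
              rintro ⟨n, hn, h1, h2⟩
              cases n with
              | zero => exact absurd (hω ▸ h1) hx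
              | succ n => exact ⟨n, by omega, h1, h2⟩
          _ = avg (fun y => P y (E N)) x := hP.first_step hd x (hE N)
          _ ≤ avg (fun y => a * f y) x := avg_mono ih x
          _ = a * avg f x := avg_const_mul a f x
          _ ≤ a * f x := by gcongr; exact hf x
  have hU : {ω | ∃ n, ω n ∈ D ∧ shift^[n] ω ∈ B} = ⋃ N, E N := by
    ext ω
    simp only [E, Set.mem_iUnion, Set.mem_ofPred_eq]
    exact ⟨fun ⟨n, h⟩ => ⟨n + 1, n, by omega, h⟩, fun ⟨_, n, _, h⟩ => ⟨n, h⟩⟩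
  have hmono : Monotone E := fun N M hNM ω ⟨n, hn, h⟩ => ⟨n, hn.trans_le hNM, h⟩
  rw [hU, hmono.measure_iUnion]
  exact iSup_le fun N => hmain N x

/-- A potential that is strictly superharmonic at `y` bounds the Green function at `y`. -/
theorem IsSRW.sum_visits_le (hd : 0 < d) (hP : IsSRW d P) {y : Zd d} {δ : ENNReal}
    {f : Zd d → ENNReal} (hf : ∀ x, avg f x + (if x = y then δ else 0) ≤ f x) (N : ℕ)
    (x : Zd d) : δ * ∑ n ∈ Finset.range N, P x {ω | ω n = y} ≤ f x := by
  have hprob := hP.1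
  induction N generalizing x with
  | zero => simp
  | succ N ih =>
    rw [Finset.sum_range_succ', mul_add]
    refine le_trans (add_le_add ?_ ?_) (hf x)
    · calc δ * ∑ n ∈ Finset.range N, P x {ω | ω (n + 1) = y}
          = δ * ∑ n ∈ Finset.range N, avg (fun z => P z {ω | ω n = y}) x := by
            congr 1
            exact Finset.sum_congr rfl fun n _ =>
              hP.first_step hd x (measurableSet_eval n {y})
        _ = avg (fun z => δ * ∑ n ∈ Finset.range N, P z {ω | ω n = y}) x := by
            rw [avg_const_mul, avg_finset_sum]
        _ ≤ avg f x := avg_mono ih x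
    · split_ifs with h
      · exact mul_le_of_le_one_right' prob_le_one
      · have : P x {ω | ω 0 = y} = 0 := by
          refine measure_mono_null (fun ω (hω : ω 0 = y) => ?_) (hP.ae_start x)
          exact fun h' => h (h'.symm.trans hω)
        simp [this]

end Walk

/-- The potential `(|x|² + 16)^(-1/2)`, superharmonic in all dimensions `d ≥ 3`. -/
noncomputable def pot (x : Zd d) : ℝ := (√(∑ i, (x i : ℝ) ^ 2 + 16))⁻¹

lemma pot_pos (x : Zd d) : 0 < pot x := by unfold pot; positivity

lemma inv_sqrt_add_inv_sqrt_le {t : ℝ} (ht : t ^ 2 ≤ 1 / 4) :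
    (√(1 + t))⁻¹ + (√(1 - t))⁻¹ ≤ 2 + 3 / 4 * t ^ 2 + t ^ 4 := by
  have h1 : 0 < 1 + t := by nlinarith
  have h2 : 0 < 1 - t := by nlinarith
  set v := t ^ 2 with hv
  have hv0 : 0 ≤ v := sq_nonneg t
  have ht4 : t ^ 4 = v ^ 2 := by rw [hv]; ring
  have hw : 0 < 1 - v := by linarith
  refine (abs_le_of_sq_le_sq' ?_ (by positivity)).2
  have hprod : (√(1 + t))⁻¹ * (√(1 - t))⁻¹ = (√(1 - v))⁻¹ := by
    rw [← mul_inv, ← Real.sqrt_mul h1.le]; congr 2; rw [hv]; ring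
  have e1 : ((√(1 + t))⁻¹) ^ 2 = (1 + t)⁻¹ := by rw [inv_pow, Real.sq_sqrt h1.le]
  have e2 : ((√(1 - t))⁻¹) ^ 2 = (1 - t)⁻¹ := by rw [inv_pow, Real.sq_sqrt h2.le]
  have e3 : (1 + t)⁻¹ + (1 - t)⁻¹ = 2 * (1 - v)⁻¹ := by
    have : (1 - v) = (1 + t) * (1 - t) := by rw [hv]; ring
    rw [this]; field_simp; ring
  have b1 : (1 - v)⁻¹ ≤ 1 + v + 4 / 3 * v ^ 2 := by
    rw [inv_le_iff_one_le_mul₀ hw]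
    nlinarith [mul_nonneg (mul_nonneg hv0 hv0) (sub_nonneg.2 ht)]
  have b2 : (√(1 - v))⁻¹ ≤ 1 + v / 2 + v ^ 2 / 2 := by
    rw [inv_le_comm₀ (by positivity) (by positivity)]
    refine Real.le_sqrt_of_sq_le ?_
    rw [inv_pow, inv_le_iff_one_le_mul₀ (by positivity)]
    nlinarith [mul_nonneg (mul_nonneg hv0 hv0) (sub_nonneg.2 ht), pow_nonneg hv0 3,
      pow_nonneg hv0 4, mul_nonneg (pow_nonneg hv0 3) (sub_nonneg.2 ht),
      mul_nonneg (pow_nonneg hv0 4) (sub_nonneg.2 ht)]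
  calc ((√(1 + t))⁻¹ + (√(1 - t))⁻¹) ^ 2
      = ((1 + t)⁻¹ + (1 - t)⁻¹) + 2 * (√(1 - v))⁻¹ := by
        rw [add_sq, e1, e2, mul_assoc, hprod]; ring
    _ ≤ 2 * (1 + v + 4 / 3 * v ^ 2) + 2 * (1 + v / 2 + v ^ 2 / 2) := by rw [e3]; linarith
    _ ≤ (2 + 3 / 4 * v + t ^ 4) ^ 2 := by rw [ht4]; nlinarith [pow_nonneg hv0 3, pow_nonneg hv0 4]

lemma pot_add_unitStep (x : Zd d) (i : Fin d) (b : Bool) :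
    pot (x + unitStep (i, b)) =
      (√(∑ j, (x j : ℝ) ^ 2 + 17 + (if b then 1 else -1) * (2 * x i)))⁻¹ := by
  have h : ∑ j ∈ Finset.univ.erase i, (((x + unitStep (i, b)) j : ℤ) : ℝ) ^ 2 =
      ∑ j ∈ Finset.univ.erase i, (x j : ℝ) ^ 2 := by
    refine Finset.sum_congr rfl fun j hj => ?_
    simp [unitStep, Pi.single_eq_of_ne (Finset.ne_of_mem_erase hj)]
  unfold pot
  congr 2
  rw [← Finset.add_sum_erase Finset.univ (fun j => (((x + unitStep (i, b)) j : ℤ) : ℝ) ^ 2)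
      (Finset.mem_univ i), ← Finset.add_sum_erase Finset.univ (fun j => (x j : ℝ) ^ 2)
      (Finset.mem_univ i), h]
  cases b <;> simp [unitStep] <;> ring

lemma sum_pot_unitStep_le (hd : 3 ≤ d) (x : Zd d) :
    ∑ s, pot (x + unitStep s) ≤ 2 * d * pot x := by
  have hd' : (3 : ℝ) ≤ d := by exact_mod_cast hd
  set m : ℝ := ∑ j, (x j : ℝ) ^ 2 with hm
  have hm0 : 0 ≤ m := Finset.sum_nonneg fun _ _ => sq_nonneg _
  set σ : ℝ := m + 17 with hσ
  have hσ0 : 0 < σ := by linarith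
  let t : Fin d → ℝ := fun i => 2 * x i / σ
  have ht : ∑ i, t i ^ 2 = 4 * m / σ ^ 2 := by
    simp only [t, div_pow, mul_pow, ← Finset.sum_div, ← Finset.mul_sum, ← hm]
    norm_num
  have hT : 4 * m / σ ^ 2 ≤ 1 / 4 := by
    rw [div_le_div_iff₀ (by positivity) (by norm_num), hσ]
    nlinarith
  have hT' : (4 * m / σ ^ 2) ^ 2 ≤ 16 / σ ^ 2 := by
    rw [div_pow, ← pow_mul, div_le_div_iff₀ (by positivity) (by positivity)]
    have : m ^ 2 ≤ σ ^ 2 := by gcongr; linarith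
    calc (4 * m) ^ 2 * σ ^ 2 = 16 * (m ^ 2 * σ ^ 2) := by ring
      _ ≤ 16 * (σ ^ 2 * σ ^ 2) := by gcongr
      _ = 16 * σ ^ (2 * 2) := by ring
  have hti : ∀ i, t i ^ 2 ≤ 4 * m / σ ^ 2 := fun i => by
    rw [← ht]
    exact Finset.single_le_sum (f := fun i => t i ^ 2) (fun _ _ => sq_nonneg _)
      (Finset.mem_univ i)
  have hpair : ∀ i, pot (x + unitStep (i, true)) + pot (x + unitStep (i, false)) ≤
      (√σ)⁻¹ * (2 + 3 / 4 * t i ^ 2 + t i ^ 2 * (4 * m / σ ^ 2)) := fun i => by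
    have e : ∀ b : Bool, pot (x + unitStep (i, b)) =
        (√σ)⁻¹ * (√(1 + (if b then 1 else -1) * t i))⁻¹ := fun b => by
      rw [pot_add_unitStep, ← mul_inv, ← Real.sqrt_mul hσ0.le]
      congr 2
      simp only [t]
      field_simp
      rw [hσ, hm]
    rw [e, e, ← mul_add]
    refine mul_le_mul_of_nonneg_left ?_ (by positivity)
    have h := inv_sqrt_add_inv_sqrt_le ((hti i).trans hT)
    have h4 : t i ^ 4 ≤ t i ^ 2 * (4 * m / σ ^ 2) := by
      nlinarith [mul_le_mul_of_nonneg_left (hti i) (sq_nonneg (t i))]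
    simp only [if_true, one_mul, Bool.false_eq_true, if_false, neg_one_mul, ← sub_eq_add_neg]
    linarith
  have hs : 0 < σ - 1 := by linarith
  have hfin : (√σ)⁻¹ * (1 + 1 / (2 * σ)) ≤ pot x := by
    have : pot x = (√(σ - 1))⁻¹ := by
      unfold pot
      rw [← hm]
      congr 2
      rw [hσ]; ring
    rw [this, inv_mul_le_iff₀ (by positivity), ← div_eq_mul_inv, le_div_iff₀ (by positivity)]
    refine Real.le_sqrt_of_sq_le ?_
    rw [mul_pow, Real.sq_sqrt hs.le]
    have : (1 + 1 / (2 * σ)) ^ 2 * (σ - 1) = σ - (3 * σ + 1) / (4 * σ ^ 2) := by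
      field_simp; ring
    rw [this]
    have : 0 ≤ (3 * σ + 1) / (4 * σ ^ 2) := by positivity
    linarith
  calc ∑ s, pot (x + unitStep s)
      = ∑ i, (pot (x + unitStep (i, true)) + pot (x + unitStep (i, false))) := by
        rw [Fintype.sum_prod_type]
        simp
    _ ≤ ∑ i, (√σ)⁻¹ * (2 + 3 / 4 * t i ^ 2 + t i ^ 2 * (4 * m / σ ^ 2)) :=
        Finset.sum_le_sum fun i _ => hpair i
    _ = (√σ)⁻¹ * (2 * d + 3 / 4 * (4 * m / σ ^ 2) + (4 * m / σ ^ 2) ^ 2) := by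
        rw [← Finset.mul_sum, Finset.sum_add_distrib, Finset.sum_add_distrib, ← Finset.sum_mul,
          ← Finset.mul_sum, ht]
        simp
        left; ring
    _ ≤ (√σ)⁻¹ * (2 * d + d / σ) := by
        refine mul_le_mul_of_nonneg_left ?_ (by positivity)
        rw [add_assoc]
        refine add_le_add_right ?_ _
        calc 3 / 4 * (4 * m / σ ^ 2) + (4 * m / σ ^ 2) ^ 2
            ≤ 3 / 4 * (4 * m / σ ^ 2) + 16 / σ ^ 2 := by gcongr
          _ = (3 * m + 16) / σ ^ 2 := by ring
          _ ≤ (3 * σ) / σ ^ 2 := by gcongr; linarith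
          _ = 3 / σ := by field_simp
          _ ≤ d / σ := by gcongr
    _ = 2 * d * ((√σ)⁻¹ * (1 + 1 / (2 * σ))) := by field_simp
    _ ≤ 2 * d * pot x := by gcongr

lemma avg_ofReal (f : Zd d → ℝ) (hf : ∀ x, 0 ≤ f x) (hd : 0 < d) (x : Zd d) :
    avg (fun y => ENNReal.ofReal (f y)) x =
      ENNReal.ofReal ((∑ s, f (x + unitStep s)) / (2 * d)) := by
  have h : (0 : ℝ) < 2 * d := by positivity
  rw [ENNReal.ofReal_div_of_pos h, ENNReal.ofReal_sum_of_nonneg fun _ _ => hf _, avg,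
    ENNReal.div_eq_inv_mul, ENNReal.ofReal_mul (by norm_num)]
  simp

lemma avg_pot_le (hd : 3 ≤ d) (x : Zd d) :
    avg (fun y => ENNReal.ofReal (pot y)) x ≤ ENNReal.ofReal (pot x) := by
  rw [avg_ofReal pot (fun x => (pot_pos x).le) (by omega)]
  refine ENNReal.ofReal_le_ofReal ?_
  have : (0 : ℝ) < 2 * d := by have : 0 < d := by omega
                               positivity
  rw [div_le_iff₀' this]
  exact sum_pot_unitStep_le hd x

lemma exists_avg_pot_add_le (hd : 3 ≤ d) : ∃ δ : ENNReal, δ ≠ 0 ∧ ∀ x : Zd d,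
    avg (fun y => ENNReal.ofReal (pot y)) x + (if x = 0 then δ else 0) ≤
      ENNReal.ofReal (pot x) := by
  have hd0 : (0 : ℝ) < d := by exact_mod_cast (show 0 < d by omega)
  have hlt : (√17)⁻¹ < (√16 : ℝ)⁻¹ := by
    gcongr
    norm_num
  refine ⟨ENNReal.ofReal ((√16)⁻¹ - (√17)⁻¹), ?_, fun x => ?_⟩
  · rw [Ne, ENNReal.ofReal_eq_zero, not_le]
    linarith
  · split_ifs with h
    · subst h
      rw [avg_ofReal pot (fun x => (pot_pos x).le) (by omega),
        ← ENNReal.ofReal_add (div_nonneg (Finset.sum_nonneg fun _ _ => (pot_pos _).le)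
          (by positivity)) (by linarith)]
      refine ENNReal.ofReal_le_ofReal ?_
      have h1 : ∀ s : Fin d × Bool, pot ((0 : Zd d) + unitStep s) = (√17)⁻¹ := fun s => by
        rw [pot_add_unitStep]; simp
      have h2 : pot (0 : Zd d) = (√16)⁻¹ := by simp [pot]
      simp only [h1, h2, Finset.sum_const, Finset.card_univ, Fintype.card_prod, Fintype.card_fin,
        Fintype.card_bool, nsmul_eq_mul, Nat.cast_mul, Nat.cast_ofNat]
      field_simp
      linarith
    · rw [add_zero]
      exact avg_pot_le hd x

/-- Transience: almost surely the walk eventually leaves a finite set forever. -/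
theorem IsSRW.ae_eventually_notMem (hd : 3 ≤ d) {P : Zd d → Measure (ℕ → Zd d)}
    (hP : IsSRW d P) (X : Finset (Zd d)) (x : Zd d) : ∀ᵐ ω ∂P x, ∀ᶠ n in atTop, ω n ∉ X := by
  have hone : ∀ y, ∀ᵐ ω ∂P x, ∀ᶠ n in atTop, ω n ≠ y := by
    intro y
    obtain ⟨δ, hδ, h⟩ := exists_avg_pot_add_le hd
    refine MeasureTheory.ae_eventually_notMem (s := fun n => {ω : ℕ → Zd d | ω n = y}) ?_
    have hb : ∀ N, ∑ n ∈ Finset.range N, P x {ω | ω n = y} ≤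
        ENNReal.ofReal (pot (x - y)) / δ := fun N => by
      rw [ENNReal.le_div_iff_mul_le (Or.inl hδ) (Or.inr ENNReal.ofReal_ne_top), mul_comm]
      refine hP.sum_visits_le (by omega) (f := fun z => ENNReal.ofReal (pot (z - y)))
        (fun z => ?_) N x
      rw [avg_translate (fun z => ENNReal.ofReal (pot z))]
      simpa only [sub_eq_zero] using h (z - y)
    exact ne_top_of_le_ne_top (ENNReal.div_ne_top ENNReal.ofReal_ne_top hδ)
      (ENNReal.tsum_le_of_sum_range_le hb)
  have hall : ∀ᵐ ω ∂P x, ∀ y ∈ X, ∀ᶠ n in atTop, ω n ≠ y :=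
    (ae_ball_iff X.countable_toSet).2 fun y _ => hone y
  filter_upwards [hall] with ω hω
  have := (Filter.eventually_all_finset X).2 hω
  filter_upwards [this] with n hn h
  exact hn _ h rfl

/-- The `n`-step transition probabilities of the walk whose positive-time part avoids `K`. -/
noncomputable def taboo (K : Set (Zd d)) : ℕ → Zd d → Zd d → ENNReal
  | 0, y, x => open Classical in if y = x then 1 else 0
  | n + 1, y, x => avg (fun z => Kᶜ.indicator (fun z => taboo K n z x) z) y

lemma avg_comm (f : Zd d → Zd d → ENNReal) (x y : Zd d) :
    avg (fun z => avg (fun z' => f z z') y) x = avg (fun z' => avg (fun z => f z z') x) y := by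
  simp only [avg, ← Finset.mul_sum]
  rw [Finset.sum_comm]

lemma sum_neg_unitStep (f : Zd d → ENNReal) :
    ∑ s : Fin d × Bool, f (-unitStep s) = ∑ s : Fin d × Bool, f (unitStep s) := by
  rw [Fintype.sum_prod_type, Fintype.sum_prod_type]
  refine Finset.sum_congr rfl fun i _ => ?_
  simp [neg_unitStep, add_comm]

lemma taboo_succ_right (K : Set (Zd d)) (n : ℕ) (y x : Zd d) :
    taboo K (n + 1) y x = Kᶜ.indicator (fun x => avg (fun z => taboo K n y z) x) x := by
  classical
  induction n generalizing y x with
  | zero =>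
    have h : avg (fun z => if z = x then (1 : ENNReal) else 0) y =
        avg (fun z => if y = z then (1 : ENNReal) else 0) x := by
      unfold avg
      congr 1
      rw [← sum_neg_unitStep (fun s => if y = x + s then (1 : ENNReal) else 0)]
      refine Finset.sum_congr rfl fun s _ => ?_
      simp only [← sub_eq_add_neg, eq_sub_iff_add_eq]
    by_cases hx : x ∈ K
    · rw [Set.indicator_of_notMem (by simpa using hx)]
      unfold taboo avg
      rw [Finset.sum_eq_zero, mul_zero]
      intro s _
      by_cases hs : y + unitStep s = x
      · simp [hs, hx]
      · simp [taboo, hs, Set.indicator_apply]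
    · rw [Set.indicator_of_mem (by simpa using hx)]
      simp only [taboo]
      rw [← h]
      unfold avg
      congr 1
      refine Finset.sum_congr rfl fun s _ => ?_
      by_cases hs : y + unitStep s = x
      · simp [hs, hx]
      · simp [hs, Set.indicator_apply]
  | succ n ih =>
    have h : taboo K (n + 1 + 1) y x =
        avg (fun z => Kᶜ.indicator (fun z => taboo K (n + 1) z x) z) y := rfl
    rw [h]
    simp only [ih]
    by_cases hx : x ∈ K
    · have hx' : x ∉ Kᶜ := by simpa using hx
      simp [Set.indicator_of_notMem hx', avg]
    · have hx' : x ∈ Kᶜ := hx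
      simp only [Set.indicator_of_mem hx']
      have e : ∀ z, Kᶜ.indicator (fun z => avg (fun z' => taboo K n z z') x) z =
          avg (fun z' => Kᶜ.indicator (fun z => taboo K n z z') z) x := fun z => by
        by_cases hz : z ∈ K
        · simp [Set.indicator_of_notMem (show z ∉ Kᶜ by simpa using hz), avg]
        · simp [Set.indicator_of_mem (show z ∈ Kᶜ from hz)]
      simp only [e]
      rw [avg_comm]
      simp only [← ih]
      rfl

section Walk

variable {P : Zd d → Measure (ℕ → Zd d)}

/-- The probability of never returning to `X`. -/
noncomputable def escape (P : Zd d → Measure (ℕ → Zd d)) (X : Set (Zd d)) (x : Zd d) : ENNReal :=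
  P x {ω | ∀ n, 1 ≤ n → ω n ∉ X}

lemma measurableSet_forall_notMem (p : ℕ → Prop) (X : Set (Zd d)) (f : ℕ → ℕ) :
    MeasurableSet {ω : ℕ → Zd d | ∀ n, p n → ω (f n) ∉ X} := by
  simp only [Set.ofPred_forall]
  exact MeasurableSet.iInter fun n => MeasurableSet.iInter fun _ => measurableSet_eval _ Xᶜ

/-- The event that the last visit to `X` happens at time `n` in `x`, and that `K` is avoided
at the times `1, …, n`. -/
def lastExit (K X : Set (Zd d)) (n : ℕ) (x : Zd d) : Set (ℕ → Zd d) :=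
  {ω | (∀ k, 1 ≤ k ∧ k ≤ n → ω k ∉ K) ∧ ω n = x ∧ ∀ k, 1 ≤ k → ω (n + k) ∉ X}

/-- The event that the first visit to `K` happens at time `n` in `y`. -/
def firstHit (K : Set (Zd d)) (n : ℕ) (y : Zd d) : Set (ℕ → Zd d) :=
  {ω | (∀ k, k < n → ω k ∉ K) ∧ ω n = y}

lemma measurableSet_lastExit (K X : Set (Zd d)) (n : ℕ) (x : Zd d) :
    MeasurableSet (lastExit K X n x) :=
  (measurableSet_forall_notMem _ K id).inter
    ((measurableSet_eval n {x}).inter (measurableSet_forall_notMem _ X (n + ·)))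

lemma measurableSet_firstHit (K : Set (Zd d)) (n : ℕ) (y : Zd d) :
    MeasurableSet (firstHit K n y) :=
  (measurableSet_forall_notMem _ K id).inter (measurableSet_eval n {y})

lemma IsSRW.measure_lastExit (hd : 0 < d) (hP : IsSRW d P) (K X : Set (Zd d)) (n : ℕ)
    (y x : Zd d) : P y (lastExit K X n x) = taboo K n y x * escape P X x := by
  classical
  induction n generalizing y with
  | zero =>
    by_cases h : y = x
    · subst h
      simp only [taboo, if_true, one_mul, escape]
      refine measure_congr ?_
      filter_upwards [hP.ae_start y] with ω hω
      refine propext ⟨fun h n hn => by simpa using h.2.2 n hn,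
        fun h => ⟨fun k hk => by omega, hω, fun k hk => by simpa using h k hk⟩⟩
    · simp only [taboo, h, if_false, zero_mul]
      refine measure_mono_null (fun ω hω => ?_) (hP.ae_start y)
      exact fun h' => h (h'.symm.trans hω.2.1)
  | succ n ih =>
    have h1 : lastExit K X (n + 1) x = shift ⁻¹' ({ω | ω 0 ∈ Kᶜ} ∩ lastExit K X n x) := by
      ext ω
      constructor
      · rintro ⟨h1, h2, h3⟩
        refine ⟨h1 1 (by omega), fun k hk => h1 (k + 1) (by omega), h2, fun k hk => ?_⟩
        have := h3 k hk
        rwa [add_right_comm] at this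
      · rintro ⟨h0, h1, h2, h3⟩
        refine ⟨fun k hk => ?_, h2, fun k hk => ?_⟩
        · obtain ⟨k, rfl⟩ := Nat.exists_eq_add_of_le' hk.1
          rcases Nat.eq_zero_or_pos k with rfl | hk0
          · exact h0
          · exact h1 k (by omega)
        · rw [add_right_comm]
          exact h3 k hk
    rw [h1, hP.first_step hd y ((measurableSet_eval 0 Kᶜ).inter (measurableSet_lastExit K X n x)),
      taboo, mul_comm, ← avg_const_mul]
    congr 1
    ext z
    by_cases hz : z ∈ K
    · rw [Set.indicator_of_notMem (by simpa using hz), mul_zero]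
      refine measure_mono_null (fun ω hω => ?_) (hP.ae_start z)
      exact fun h' => hω.1 (h' ▸ hz)
    · rw [Set.indicator_of_mem (by simpa using hz), mul_comm, ← ih]
      refine measure_congr ?_
      filter_upwards [hP.ae_start z] with ω hω
      exact propext ⟨fun h => h.2, fun h => ⟨by change ω 0 ∉ K; rwa [hω], h⟩⟩

lemma IsSRW.measure_firstHit (hd : 0 < d) (hP : IsSRW d P) (K : Set (Zd d)) (n : ℕ)
    (x y : Zd d) : P x (firstHit K n y) = taboo K n y x := by
  classical
  have hprob := hP.1
  induction n generalizing x with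
  | zero =>
    by_cases h : y = x
    · subst h
      simp only [taboo, if_true]
      rw [← measure_univ (μ := P y)]
      refine measure_congr ?_
      filter_upwards [hP.ae_start y] with ω hω
      exact propext ⟨fun _ => trivial, fun _ => ⟨fun k hk => by omega, hω⟩⟩
    · simp only [taboo, h, if_false]
      refine measure_mono_null (fun ω hω => ?_) (hP.ae_start x)
      exact fun h' => h (hω.2.symm.trans h')
  | succ n ih =>
    rw [taboo_succ_right]
    by_cases hx : x ∈ K
    · rw [Set.indicator_of_notMem (by simpa using hx)]
      refine measure_mono_null (fun ω hω => ?_) (hP.ae_start x)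
      exact fun h' => hω.1 0 (by omega) (h' ▸ hx)
    · rw [Set.indicator_of_mem (by simpa using hx)]
      simp only [← ih]
      rw [← hP.first_step hd x (measurableSet_firstHit K n y)]
      refine measure_congr ?_
      filter_upwards [hP.ae_start x] with ω hω
      refine propext ⟨fun h => ⟨fun k hk => h.1 (k + 1) (by omega), h.2⟩,
        fun h => ⟨fun k hk => ?_, h.2⟩⟩
      cases k with
      | zero => rwa [hω]
      | succ k => exact h.1 k (by omega)

/-- The sweeping identity: the capacity of `K ⊆ X` is the mass of the equilibrium measure of
`X` carried by the paths that hit `K`. -/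
theorem IsSRW.sum_escape_eq (hd : 3 ≤ d) (hP : IsSRW d P) {K X : Finset (Zd d)} (hKX : K ⊆ X) :
    ∑ y ∈ K, escape P K y = ∑ x ∈ X, escape P X x * P x {ω | ∃ n, ω n ∈ K} := by
  have hd0 : 0 < d := by omega
  have h1 : ∀ y ∈ K, escape P K y = ∑' n, ∑ x ∈ X, taboo K n y x * escape P X x := by
    intro y hy
    have hU : P y {ω | ∀ n, 1 ≤ n → ω n ∉ (K : Set (Zd d))} =
        P y (⋃ p : ℕ × X, lastExit K X p.1 p.2) := by
      refine measure_congr ?_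
      filter_upwards [hP.ae_start y, hP.ae_eventually_notMem hd X y] with ω h0 hev
      refine propext ⟨fun h => ?_, fun h => ?_⟩
      · obtain ⟨N, hN⟩ := eventually_atTop.1 hev
        have hex : ∃ n, ∀ k, 1 ≤ k → ω (n + k) ∉ X := ⟨N, fun k _ => hN _ (by omega)⟩
        classical
        let n := Nat.find hex
        have hn := Nat.find_spec hex
        have hmem : ω n ∈ X := by
          rcases Nat.eq_zero_or_pos n with hn0 | hn0
          · rw [hn0, h0]; exact hKX hy
          · by_contra hc
            refine Nat.find_min hex (m := n - 1) (by omega) fun k hk => ?_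
            rcases hk.eq_or_lt with rfl | hk
            · rwa [Nat.sub_add_cancel hn0]
            · have := hn (k - 1) (by omega)
              rwa [show n - 1 + k = n + (k - 1) by omega]
        exact Set.mem_iUnion.2 ⟨(n, ⟨ω n, hmem⟩), fun k hk => h k hk.1, rfl, hn⟩
      · obtain ⟨p, h1, h2, h3⟩ := Set.mem_iUnion.1 h
        intro k hk
        by_cases hkp : k ≤ p.1
        · exact h1 k ⟨hk, hkp⟩
        · have := h3 (k - p.1) (by omega)
          rw [show p.1 + (k - p.1) = k by omega] at this
          exact fun h => this (hKX h)
    rw [escape, hU, measure_iUnion]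
    · rw [ENNReal.tsum_prod']
      refine tsum_congr fun n => ?_
      rw [tsum_fintype, ← Finset.sum_coe_sort X]
      exact Finset.sum_congr rfl fun x _ => hP.measure_lastExit hd0 K X n y x
    · intro p q hpq
      refine Set.disjoint_left.2 fun ω hp hq => hpq ?_
      have key : ∀ p q : ℕ × X, ω ∈ lastExit K X p.1 p.2 → ω ∈ lastExit K X q.1 q.2 →
          ¬ p.1 < q.1 := fun p q hp hq hlt => by
        have := hp.2.2 (q.1 - p.1) (by omega)
        rw [show p.1 + (q.1 - p.1) = q.1 by omega, hq.2.1] at this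
        exact this q.2.2
      have h1 : p.1 = q.1 := le_antisymm (not_lt.1 (key q p hq hp)) (not_lt.1 (key p q hp hq))
      refine Prod.ext h1 (Subtype.ext ?_)
      rw [← hp.2.1, ← hq.2.1, h1]
    · exact fun p => measurableSet_lastExit _ _ _ _
  have h2 : ∀ x, P x {ω | ∃ n, ω n ∈ K} = ∑' n, ∑ y ∈ K, taboo K n y x := by
    intro x
    have hU : {ω : ℕ → Zd d | ∃ n, ω n ∈ K} = ⋃ p : ℕ × K, firstHit K p.1 p.2 := by
      ext ω
      simp only [Set.mem_iUnion, Set.mem_ofPred_eq]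
      constructor
      · intro h
        classical
        exact ⟨(Nat.find h, ⟨_, Nat.find_spec h⟩), fun k hk => Nat.find_min h hk, rfl⟩
      · rintro ⟨p, -, h⟩
        exact ⟨p.1, h ▸ p.2.2⟩
    rw [hU, measure_iUnion]
    · rw [ENNReal.tsum_prod']
      refine tsum_congr fun n => ?_
      rw [tsum_fintype, ← Finset.sum_coe_sort K]
      exact Finset.sum_congr rfl fun y _ => hP.measure_firstHit hd0 K n x y
    · intro p q hpq
      refine Set.disjoint_left.2 fun ω hp hq => hpq ?_
      have key : ∀ p q : ℕ × K, ω ∈ firstHit K p.1 p.2 → ω ∈ firstHit K q.1 q.2 →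
          ¬ p.1 < q.1 := fun p q hp hq hlt => hq.1 p.1 hlt (hp.2 ▸ p.2.2)
      have h1 : p.1 = q.1 := le_antisymm (not_lt.1 (key q p hq hp)) (not_lt.1 (key p q hp hq))
      refine Prod.ext h1 (Subtype.ext ?_)
      rw [← hp.2, ← hq.2, h1]
    · exact fun p => measurableSet_firstHit _ _ _
  rw [Finset.sum_congr rfl h1, ← Summable.tsum_finsetSum fun _ _ => ENNReal.summable]
  simp only [h2, ← ENNReal.tsum_mul_left]
  rw [← Summable.tsum_finsetSum fun _ _ => ENNReal.summable]
  refine tsum_congr fun n => ?_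
  rw [Finset.sum_comm]
  refine Finset.sum_congr rfl fun x _ => ?_
  rw [Finset.mul_sum]
  exact Finset.sum_congr rfl fun y _ => mul_comm _ _

end Walk

section Combinatorics

variable {ι : Type*} [DecidableEq ι]

/-- If the intersections indexed by `S` of certain events have probability
`exp (-∑ m A)`, summed over the `A ∈ 𝒜` that meet `S`, then the inclusion–exclusion sum for the
probability that none of the events indexed by `U` occurs decays exponentially in
the cardinality of `U`. -/
lemma sum_powerset_exp_le {m : Finset ι → ℝ} (hm : ∀ A, 0 ≤ m A) {r : ℝ} (hr : 1 ≤ r)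
    (𝒜 : Finset (Finset ι)) (U : Finset ι) :
    ∑ S ∈ U.powerset, (-1 : ℝ) ^ S.card * Real.exp (-∑ A ∈ 𝒜 with ¬Disjoint A S, m A) ≤
      (r ^ U.card)⁻¹ * Real.exp (∑ A ∈ 𝒜, m A * (r ^ A.card - 1)) := by
  have hr0 : 0 < r := by linarith
  induction 𝒜 using Finset.induction_on generalizing U with
  | empty =>
    have h := Finset.sum_powerset_neg_one_pow_card (x := U)
    have h' : ∑ S ∈ U.powerset, (-1 : ℝ) ^ S.card = if U = ∅ then 1 else 0 := by
      exact_mod_cast congrArg (Int.cast : ℤ → ℝ) h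
    simp only [Finset.filter_empty, Finset.sum_empty, neg_zero, Real.exp_zero, mul_one, h']
    split_ifs with hU
    · simp [hU]
    · positivity
  | insert A 𝒜 hA ih =>
    set q := Real.exp (-m A) with hq
    have hq1 : q ≤ 1 := Real.exp_le_one_iff.2 (by linarith [hm A])
    have hq0 : 0 < q := Real.exp_pos _
    set E : Finset ι → ℝ := fun S =>
      (-1 : ℝ) ^ S.card * Real.exp (-∑ A ∈ 𝒜 with ¬Disjoint A S, m A) with hE
    have hsplit : ∀ S : Finset ι,
        (-1 : ℝ) ^ S.card * Real.exp (-∑ A ∈ insert A 𝒜 with ¬Disjoint A S, m A) =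
          q * E S + (1 - q) * if Disjoint A S then E S else 0 := by
      intro S
      by_cases h : Disjoint A S
      · rw [Finset.filter_insert, if_neg (not_not.2 h), if_pos h]
        ring
      · rw [Finset.filter_insert, if_pos h, if_neg h, Finset.sum_insert (by simp [hA]), neg_add,
          Real.exp_add]
        simp only [hE, hq]
        ring
    have hfilter : U.powerset.filter (fun S => Disjoint A S) = (U \ A).powerset := by
      ext S
      simp only [Finset.mem_filter, Finset.mem_powerset, Finset.subset_sdiff, disjoint_comm]
    rw [Finset.sum_congr rfl fun S _ => hsplit S, Finset.sum_add_distrib, ← Finset.mul_sum,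
      ← Finset.mul_sum, ← Finset.sum_filter, hfilter, Finset.sum_insert hA, Real.exp_add]
    set X := Real.exp (∑ A ∈ 𝒜, m A * (r ^ A.card - 1))
    have hX : 0 < X := Real.exp_pos _
    have hcard : (r ^ (U \ A).card)⁻¹ ≤ (r ^ U.card)⁻¹ * r ^ A.card := by
      have h1 : r ^ U.card ≤ r ^ (U \ A).card * r ^ A.card := by
        rw [← pow_add]
        refine pow_le_pow_right₀ hr ?_
        have := Finset.card_le_card_sdiff_add_card (s := U) (t := A)
        omega
      rw [← div_eq_inv_mul, le_div_iff₀ (by positivity), inv_mul_le_iff₀ (by positivity)]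
      exact h1
    have hexp : q + (1 - q) * r ^ A.card ≤ Real.exp (m A * (r ^ A.card - 1)) := by
      have h1 := Real.add_one_le_exp (m A * (r ^ A.card - 1))
      have h2 := Real.add_one_le_exp (-m A)
      have h3 : 0 ≤ r ^ A.card - 1 := sub_nonneg.2 (one_le_pow₀ hr)
      nlinarith
    calc q * ∑ S ∈ U.powerset, E S + (1 - q) * ∑ S ∈ (U \ A).powerset, E S
        ≤ q * ((r ^ U.card)⁻¹ * X) + (1 - q) * ((r ^ (U \ A).card)⁻¹ * X) := by
          gcongr
          · exact ih U
          · exact ih (U \ A)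
      _ ≤ q * ((r ^ U.card)⁻¹ * X) + (1 - q) * (((r ^ U.card)⁻¹ * r ^ A.card) * X) := by
          gcongr
      _ = (r ^ U.card)⁻¹ * ((q + (1 - q) * r ^ A.card) * X) := by ring
      _ ≤ _ := by gcongr

/-- Inclusion–exclusion for the probability that none of finitely many events occurs. -/
lemma measureReal_iInter_compl {Ω : Type*} [MeasurableSpace Ω] (μ : Measure Ω)
    [IsProbabilityMeasure μ] {E : ι → Set Ω} (hE : ∀ i, MeasurableSet (E i)) (T : Finset ι) :
    μ.real (⋂ i ∈ T, (E i)ᶜ) =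
      ∑ S ∈ T.powerset, (-1 : ℝ) ^ S.card * μ.real (⋂ i ∈ S, E i) := by
  have h1 : (⋂ i ∈ T, (E i)ᶜ) = (⋃ i ∈ T, E i)ᶜ := by simp
  have hsplit : T.powerset = insert ∅ (T.powerset.filter (·.Nonempty)) := by
    ext S
    rcases S.eq_empty_or_nonempty with rfl | h
    · simp
    · simp [h, h.ne_empty]
  rw [h1, probReal_compl_eq_one_sub (Finset.measurableSet_biUnion _ fun i _ => hE i),
    measureReal_biUnion_eq_sum_powerset (fun i _ => hE i), hsplit,
    Finset.sum_insert (by simp), ← hsplit]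
  simp [pow_succ, Finset.sum_neg_distrib, sub_eq_add_neg]

end Combinatorics

section Trace

variable {ι : Type*}

/-- The indices in `T` of the sets `F z` visited by the path `ω`. -/
noncomputable def trace (F : ι → Finset (Zd d)) (T : Finset ι) (ω : ℕ → Zd d) : Finset ι :=
  open Classical in T.filter fun z => ∃ n, ω n ∈ F z

variable {F : ι → Finset (Zd d)} {T : Finset ι}

lemma mem_trace {ω : ℕ → Zd d} {z : ι} : z ∈ trace F T ω ↔ z ∈ T ∧ ∃ n, ω n ∈ F z := by
  simp [trace]

lemma trace_subset (ω : ℕ → Zd d) : trace F T ω ⊆ T := fun _ h => (mem_trace.1 h).1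

lemma trace_iterate_shift_subset (n : ℕ) (ω : ℕ → Zd d) :
    trace F T (shift^[n] ω) ⊆ trace F T ω := by
  intro z hz
  obtain ⟨h, k, hk⟩ := mem_trace.1 hz
  exact mem_trace.2 ⟨h, k + n, by rwa [iterate_shift_apply] at hk⟩

lemma measurableSet_exists_mem (X : Set (Zd d)) : MeasurableSet {ω : ℕ → Zd d | ∃ n, ω n ∈ X} := by
  simp only [Set.ofPred_exists]
  exact MeasurableSet.iUnion fun n => measurableSet_eval n X

lemma measurableSet_trace_eq (A : Finset ι) : MeasurableSet (trace F T ⁻¹' {A}) := by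
  classical
  by_cases hA : A ⊆ T
  · have : trace F T ⁻¹' {A} = ⋂ z ∈ T, if z ∈ A then {ω : ℕ → Zd d | ∃ n, ω n ∈ F z}
        else {ω : ℕ → Zd d | ∃ n, ω n ∈ F z}ᶜ := by
      ext ω
      simp only [Set.mem_preimage, Set.mem_singleton_iff, Set.mem_iInter, Finset.ext_iff, mem_trace]
      constructor
      · intro h z hz
        have := h z
        split_ifs with hzA
        · exact (this.2 hzA).2
        · exact fun hn => hzA (this.1 ⟨hz, hn⟩)
      · intro h z
        constructor
        · rintro ⟨hz, hn⟩
          by_contra hzA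
          have := h z hz
          rw [if_neg hzA] at this
          exact this hn
        · intro hzA
          have := h z (hA hzA)
          rw [if_pos hzA] at this
          exact ⟨hA hzA, this⟩
    rw [this]
    refine Finset.measurableSet_biInter _ fun z _ => ?_
    split_ifs
    · exact measurableSet_exists_mem _
    · exact (measurableSet_exists_mem _).compl
  · have : trace F T ⁻¹' {A} = ∅ := by
      ext ω
      simp only [Set.mem_preimage, Set.mem_singleton_iff, Set.mem_empty_iff_false, iff_false]
      rintro rfl
      exact hA (trace_subset ω)
    rw [this]
    exact MeasurableSet.empty

lemma preimage_trace_eq (p : Finset ι → Prop) [DecidablePred p] :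
    {ω | p (trace F T ω)} = trace F T ⁻¹' ↑(T.powerset.filter p) := by
  ext ω
  simp [trace_subset]

lemma measurableSet_trace (p : Finset ι → Prop) : MeasurableSet {ω | p (trace F T ω)} := by
  classical
  rw [preimage_trace_eq, ← Set.biUnion_preimage_singleton]
  exact Finset.measurableSet_biUnion _ fun A _ => measurableSet_trace_eq A

lemma sum_measureReal_trace (μ : Measure (ℕ → Zd d)) [IsFiniteMeasure μ] (p : Finset ι → Prop)
    [DecidablePred p] :
    ∑ A ∈ T.powerset with p A, μ.real (trace F T ⁻¹' {A}) = μ.real {ω | p (trace F T ω)} := by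
  rw [preimage_trace_eq, sum_measureReal_preimage_singleton]
  exact fun A _ => measurableSet_trace_eq A

/-- If from each `F i` the other sets are unlikely to be hit, then the number of sets visited has
geometric tails. -/
lemma IsSRW.measure_lt_card_trace_le [DecidableEq ι] (hd : 0 < d) {P : Zd d → Measure (ℕ → Zd d)}
    (hP : IsSRW d P) {h : ι → Zd d → ENNReal} {p : ENNReal}
    (hh : ∀ j x, avg (h j) x ≤ h j x) (hF : ∀ j, ∀ x ∈ F j, 1 ≤ h j x)
    (hp : ∀ i ∈ T, ∀ x ∈ F i, ∑ j ∈ T.erase i, h j x ≤ p) (k : ℕ) :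
    ∀ x ∈ T.biUnion F, P x {ω | k < (trace F T ω).card} ≤ p ^ k := by
  have hprob := hP.1
  induction k with
  | zero => exact fun x _ => by rw [pow_zero]; exact prob_le_one
  | succ k ih =>
    intro x hx
    obtain ⟨i, hi, hxi⟩ := Finset.mem_biUnion.1 hx
    set D : Set (Zd d) := ↑((T.erase i).biUnion F) with hD
    set B : Set (ℕ → Zd d) := {ω | k < (trace F T ω).card} with hB
    have hsub : {ω | k + 1 < (trace F T ω).card} ⊆ {ω | ∃ n, ω n ∈ D ∧ shift^[n] ω ∈ B} := by
      intro ω hω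
      have hcard : k < ((trace F T ω).erase i).card := by
        have h1 : (trace F T ω).card - 1 ≤ ((trace F T ω).erase i).card :=
          Finset.pred_card_le_card_erase
        have h2 : k + 1 < (trace F T ω).card := hω
        omega
      have hhit : ∀ j ∈ (trace F T ω).erase i, ∃ n, ω n ∈ F j ∧ ω n ∈ D := by
        intro j hj
        obtain ⟨hji, hj⟩ := Finset.mem_erase.1 hj
        obtain ⟨hjT, n, hn⟩ := mem_trace.1 hj
        exact ⟨n, hn, Finset.mem_biUnion.2 ⟨j, Finset.mem_erase.2 ⟨hji, hjT⟩, hn⟩⟩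
      obtain ⟨j₀, hj₀⟩ := Finset.card_pos.1 (by omega : 0 < ((trace F T ω).erase i).card)
      have hex : ∃ n, ω n ∈ D := (hhit j₀ hj₀).imp fun n h => h.2
      classical
      refine ⟨Nat.find hex, Nat.find_spec hex, hcard.trans_le (Finset.card_le_card ?_)⟩
      intro j hj
      obtain ⟨n, hnj, hnD⟩ := hhit j hj
      refine mem_trace.2 ⟨(mem_trace.1 (Finset.mem_of_mem_erase hj)).1, n - Nat.find hex, ?_⟩
      rwa [iterate_shift_apply, Nat.sub_add_cancel (Nat.find_min' hex hnD)]
    have hle := hP.measure_hit_and_shift_le hd (D := D) (B := B) (a := p ^ k)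
      (f := fun x => ∑ j ∈ T.erase i, h j x) (measurableSet_trace fun A => k < A.card)
      (fun ω hω => lt_of_lt_of_le hω
        (Finset.card_le_card (trace_iterate_shift_subset 1 ω)))
      (fun y hy => ih y (Finset.biUnion_subset_biUnion_of_subset_left _ (Finset.erase_subset _ _)
        (Finset.mem_coe.1 hy)))
      (fun x => by
        rw [avg_finset_sum]
        exact Finset.sum_le_sum fun j _ => hh j x)
      (fun x hx => by
        obtain ⟨j, hj, hxj⟩ := Finset.mem_biUnion.1 (Finset.mem_coe.1 hx)
        exact (hF j x hxj).trans
          (Finset.single_le_sum (f := fun j => h j x) (fun _ _ => zero_le) hj)) x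
    calc P x {ω | k + 1 < (trace F T ω).card} ≤ _ := measure_mono hsub
      _ ≤ _ := hle
      _ ≤ p ^ k * p := by gcongr; exact hp i hi x hxi
      _ = p ^ (k + 1) := (pow_succ _ _).symm

lemma sum_measureReal_trace_mul_le (μ : Measure (ℕ → Zd d)) [IsFiniteMeasure μ] {p r : ℝ}
    (hr : 1 ≤ r) (hp : 0 ≤ p) (hrp : r * p ≤ 1 / 2)
    (h : ∀ k, μ.real {ω | k < (trace F T ω).card} ≤ p ^ k) :
    ∑ A ∈ T.powerset, μ.real (trace F T ⁻¹' {A}) * (r ^ A.card - 1) ≤ 2 * r := by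
  have hr0 : 0 < r := by linarith
  have hpow : ∀ a : ℕ, r ^ a - 1 ≤ ∑ k ∈ Finset.range a, r ^ (k + 1) := by
    intro a
    cases a with
    | zero => simp
    | succ a =>
      rw [Finset.sum_range_succ]
      have : 0 ≤ ∑ k ∈ Finset.range a, r ^ (k + 1) := Finset.sum_nonneg fun _ _ => by positivity
      linarith
  calc ∑ A ∈ T.powerset, μ.real (trace F T ⁻¹' {A}) * (r ^ A.card - 1)
      ≤ ∑ A ∈ T.powerset, ∑ k ∈ Finset.range T.card,
          if k < A.card then r ^ (k + 1) * μ.real (trace F T ⁻¹' {A}) else 0 := by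
        refine Finset.sum_le_sum fun A hA => ?_
        have hcard := Finset.card_le_card (Finset.mem_powerset.1 hA)
        have hfilter : (Finset.range T.card).filter (fun k => k < A.card) =
            Finset.range A.card := by
          ext k
          simp only [Finset.mem_filter, Finset.mem_range]
          omega
        rw [← Finset.sum_filter, hfilter, ← Finset.sum_mul, mul_comm]
        exact mul_le_mul_of_nonneg_right (hpow _) measureReal_nonneg
    _ = ∑ k ∈ Finset.range T.card, r ^ (k + 1) * μ.real {ω | k < (trace F T ω).card} := by
        rw [Finset.sum_comm]
        refine Finset.sum_congr rfl fun k _ => ?_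
        rw [← Finset.sum_filter, ← Finset.mul_sum, sum_measureReal_trace μ fun A => k < A.card]
    _ ≤ ∑ k ∈ Finset.range T.card, r * (1 / 2) ^ k := by
        refine Finset.sum_le_sum fun k _ => ?_
        calc r ^ (k + 1) * μ.real {ω | k < (trace F T ω).card} ≤ r ^ (k + 1) * p ^ k := by
              gcongr
              exact h k
          _ = r * (r * p) ^ k := by ring
          _ ≤ _ := by gcongr
    _ ≤ r * 2 := by
        rw [← Finset.mul_sum]
        gcongr
        exact sum_geometric_two_le _
    _ = 2 * r := mul_comm _ _

end Trace

section Closed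

variable {ι : Type*} [DecidableEq ι] {F : ι → Finset (Zd d)} {T : Finset ι}

lemma IsSRW.capa_biUnion (hd : 3 ≤ d) {P : Zd d → Measure (ℕ → Zd d)} (hP : IsSRW d P)
    {S : Finset ι} (hS : S ⊆ T) :
    capa P (S.biUnion F) = ∑ A ∈ T.powerset with ¬Disjoint A S,
      ∑ x ∈ T.biUnion F,
        (escape P (T.biUnion F) x).toReal * (P x).real (trace F T ⁻¹' {A}) := by
  have hprob := hP.1
  have hesc : ∀ (X : Set (Zd d)) x, escape P X x ≠ ⊤ := fun X x => measure_ne_top _ _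
  have h := congrArg ENNReal.toReal (hP.sum_escape_eq hd
    (Finset.biUnion_subset_biUnion_of_subset_left F hS))
  rw [ENNReal.toReal_sum fun _ _ => hesc _ _,
    ENNReal.toReal_sum fun _ _ => ENNReal.mul_ne_top (hesc _ _) (measure_ne_top _ _)] at h
  have hcapa : capa P (S.biUnion F) =
      ∑ y ∈ S.biUnion F, (escape P (S.biUnion F : Finset (Zd d)) y).toReal :=
    Finset.sum_congr rfl fun y hy => Set.indicator_of_mem (Finset.mem_coe.2 hy) _
  rw [hcapa, h, Finset.sum_comm]
  refine Finset.sum_congr rfl fun x _ => ?_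
  rw [ENNReal.toReal_mul, ← Finset.mul_sum, sum_measureReal_trace (P x) fun A => ¬Disjoint A S]
  congr 2
  congr 1
  ext ω
  simp only [Set.mem_ofPred_eq, Finset.not_disjoint_iff, Finset.mem_biUnion, mem_trace]
  exact ⟨fun ⟨n, a, ha, hn⟩ => ⟨a, ⟨hS ha, n, hn⟩, ha⟩, fun ⟨a, ⟨_, n, hn⟩, ha⟩ => ⟨n, a, ha, hn⟩⟩

/-- If the sets `F z`, `z ∈ T`, are small and hardly see each other, then the probability that none
of them is entirely vacant decays exponentially in the number of sets. -/
theorem IsVacantLaw.measure_forall_exists_false_le (hd : 3 ≤ d) {P : Zd d → Measure (ℕ → Zd d)}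
    (hP : IsSRW d P) {u : ℝ} (hu : 0 ≤ u) {Q : Measure (Zd d → Bool)} (hQ : IsVacantLaw P u Q)
    {h : ι → Zd d → ENNReal} {p r : ℝ} (hr : 1 ≤ r) (hp : 0 ≤ p) (hrp : r * p ≤ 1 / 2)
    (hh : ∀ j x, avg (h j) x ≤ h j x) (hF : ∀ j, ∀ x ∈ F j, 1 ≤ h j x)
    (hpF : ∀ i ∈ T, ∀ x ∈ F i, ∑ j ∈ T.erase i, h j x ≤ ENNReal.ofReal p) {N : ℕ}
    (hN : ∀ i ∈ T, (F i).card ≤ N) (huN : u * (N * (2 * r)) ≤ 1) :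
    Q {Y | ∀ z ∈ T, ∃ x ∈ F z, Y x = false} ≤ ENNReal.ofReal ((Real.exp 1 / r) ^ T.card) := by
  have hprob := hP.1
  have hprobQ := hQ.1
  have hr0 : 0 < r := by linarith
  set X := T.biUnion F with hX
  set ν : Finset ι → ℝ := fun A =>
    ∑ x ∈ X, (escape P X x).toReal * (P x).real (trace F T ⁻¹' {A}) with hν
  have hν0 : ∀ A, 0 ≤ ν A := fun A => Finset.sum_nonneg fun x _ => by positivity
  set E : ι → Set (Zd d → Bool) := fun z => {Y | ∀ x ∈ F z, Y x = true} with hE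
  have hEm : ∀ z, MeasurableSet (E z) := by
    intro z
    simp only [hE, Set.ofPred_forall]
    exact Finset.measurableSet_biInter _ fun x _ => measurable_pi_apply x (measurableSet_singleton _)
  have hset : {Y : Zd d → Bool | ∀ z ∈ T, ∃ x ∈ F z, Y x = false} = ⋂ z ∈ T, (E z)ᶜ := by
    ext Y
    simp [hE]
  have hinter : ∀ S ∈ T.powerset, Q.real (⋂ z ∈ S, E z) =
      Real.exp (-∑ A ∈ T.powerset with ¬Disjoint A S, u * ν A) := by
    intro S hS
    have h1 : (⋂ z ∈ S, E z) = {Y | ∀ x ∈ S.biUnion F, Y x = true} := by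
      ext Y
      simp only [hE, Set.mem_iInter, Set.mem_ofPred_eq, Finset.mem_biUnion]
      exact ⟨fun h x ⟨z, hz, hx⟩ => h z hz x hx, fun h z hz x hx => h x ⟨z, hz, hx⟩⟩
    rw [h1, Measure.real, hQ.2, ENNReal.toReal_ofReal (Real.exp_pos _).le,
      hP.capa_biUnion hd (Finset.mem_powerset.1 hS), Finset.mul_sum]
  have hmoment : ∑ A ∈ T.powerset, u * ν A * (r ^ A.card - 1) ≤ T.card := by
    calc ∑ A ∈ T.powerset, u * ν A * (r ^ A.card - 1)
        = u * ∑ x ∈ X, (escape P X x).toReal *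
            ∑ A ∈ T.powerset, (P x).real (trace F T ⁻¹' {A}) * (r ^ A.card - 1) := by
          simp only [hν, Finset.mul_sum, Finset.sum_mul]
          rw [Finset.sum_comm]
          exact Finset.sum_congr rfl fun _ _ => Finset.sum_congr rfl fun _ _ => by ring
      _ ≤ u * ∑ x ∈ X, 1 * (2 * r) := by
          refine mul_le_mul_of_nonneg_left (Finset.sum_le_sum fun x hx => ?_) hu
          have h1 : (escape P X x).toReal ≤ 1 := ENNReal.toReal_le_of_le_ofReal zero_le_one
            (by rw [ENNReal.ofReal_one]; exact prob_le_one)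
          have h2 : ∀ k, (P x).real {ω | k < (trace F T ω).card} ≤ p ^ k := fun k =>
            ENNReal.toReal_le_of_le_ofReal (by positivity) (by
              rw [ENNReal.ofReal_pow hp]
              exact hP.measure_lt_card_trace_le (by omega) hh hF hpF k x hx)
          refine (mul_le_mul_of_nonneg_left
            (sum_measureReal_trace_mul_le (P x) hr hp hrp h2) ENNReal.toReal_nonneg).trans ?_
          gcongr
      _ = u * (X.card * (2 * r)) := by simp
      _ ≤ u * ((T.card * N : ℕ) * (2 * r)) := by
          gcongr
          exact Finset.card_biUnion_le_card_mul _ _ _ hN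
      _ = T.card * (u * (N * (2 * r))) := by push_cast; ring
      _ ≤ T.card := mul_le_of_le_one_right (Nat.cast_nonneg _) huN
  have hreal : Q.real (⋂ z ∈ T, (E z)ᶜ) ≤ (Real.exp 1 / r) ^ T.card := by
    rw [measureReal_iInter_compl Q hEm, Finset.sum_congr rfl fun S hS => by rw [hinter S hS]]
    refine (sum_powerset_exp_le (fun A => mul_nonneg hu (hν0 A)) hr _ _).trans ?_
    rw [div_pow, ← Real.exp_nat_mul, mul_one, div_eq_inv_mul]
    gcongr
  rw [hset, ← ofReal_measureReal]
  exact ENNReal.ofReal_le_ofReal hreal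

end Closed

section Hooks

/-- The point of the plane `ℤ e₁ + ℤ e₂` with given coordinates. -/
def planePt (z : ℤ × ℤ) : Zd d := fun i =>
  if (i : ℕ) = 0 then z.1 else if (i : ℕ) = 1 then z.2 else 0

/-- The two segments of length `L` joining `L z` to `L (z + e₁)` and `L (z + e₂)`. -/
def hook (L : ℕ) (z : ℤ × ℤ) : Finset (Zd d) :=
  (Finset.range (L + 1)).image (fun r : ℕ => planePt (L * z.1 + r, L * z.2)) ∪
    (Finset.range (L + 1)).image (fun r : ℕ => planePt (L * z.1, L * z.2 + r))

lemma mem_hook {L : ℕ} {z : ℤ × ℤ} {x : Zd d} : x ∈ hook L z ↔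
    ∃ r ≤ L, x = planePt (L * z.1 + r, L * z.2) ∨ x = planePt (L * z.1, L * z.2 + r) := by
  simp only [hook, Finset.mem_union, Finset.mem_image, Finset.mem_range, Nat.lt_succ_iff]
  constructor
  · rintro (⟨r, hr, rfl⟩ | ⟨r, hr, rfl⟩)
    exacts [⟨r, hr, Or.inl rfl⟩, ⟨r, hr, Or.inr rfl⟩]
  · rintro ⟨r, hr, rfl | rfl⟩
    exacts [Or.inl ⟨r, hr, rfl⟩, Or.inr ⟨r, hr, rfl⟩]

lemma card_hook_le (L : ℕ) (z : ℤ × ℤ) : (hook L z : Finset (Zd d)).card ≤ 2 * (L + 1) := by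
  refine (Finset.card_union_le _ _).trans ?_
  have h1 := Finset.card_image_le (s := Finset.range (L + 1))
    (f := fun r : ℕ => (planePt (L * z.1 + r, L * z.2) : Zd d))
  have h2 := Finset.card_image_le (s := Finset.range (L + 1))
    (f := fun r : ℕ => (planePt (L * z.1, L * z.2 + r) : Zd d))
  rw [Finset.card_range] at h1 h2
  omega

lemma pot_le_inv {v : Zd d} (i : Fin d) {c : ℝ} (hc : 0 < c) (h : c ≤ |(v i : ℝ)|) :
    pot v ≤ c⁻¹ := by
  unfold pot
  gcongr
  refine Real.le_sqrt_of_sq_le ?_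
  have h1 : c ^ 2 ≤ (v i : ℝ) ^ 2 := sq_le_sq' (by linarith [abs_nonneg (v i : ℝ)]) h |>.trans_eq
    (sq_abs _)
  have h2 := Finset.single_le_sum (f := fun i => (v i : ℝ) ^ 2) (fun _ _ => sq_nonneg _)
    (Finset.mem_univ i)
  linarith

lemma inv_le_pot {v : Zd d} (i : Fin d) (hv : ∀ j ≠ i, v j = 0) {c : ℝ} (hc : |(v i : ℝ)| ≤ c) :
    (c + 4)⁻¹ ≤ pot v := by
  have h0 : ∑ j, (v j : ℝ) ^ 2 = (v i : ℝ) ^ 2 :=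
    Finset.sum_eq_single_of_mem i (Finset.mem_univ i) fun j _ hj => by simp [hv j hj]
  have hc0 : 0 ≤ c := (abs_nonneg _).trans hc
  unfold pot
  rw [h0]
  gcongr
  refine Real.sqrt_le_iff.2 ⟨by linarith, ?_⟩
  have : (v i : ℝ) ^ 2 ≤ c ^ 2 := by rw [← sq_abs]; gcongr
  nlinarith

/-- The sum of the potentials of the points of an arm of a hook, seen from a point of this arm. -/
lemma sum_inv_le_sum {L r : ℕ} (hr : r ≤ L) {f : ℕ → ℝ} (hf0 : ∀ k, 0 ≤ f k)
    (hf : ∀ k : ℕ, (|(r : ℝ) - k| + 4)⁻¹ ≤ f k) :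
    ∑ j ∈ Finset.range (L / 2 + 1), ((j : ℝ) + 4)⁻¹ ≤ ∑ k ∈ Finset.range (L + 1), f k := by
  have key : ∀ g : ℕ → ℕ, (∀ j ≤ L / 2, g j ≤ L) → (∀ j ≤ L / 2, |(r : ℝ) - g j| = j) →
      ∑ j ∈ Finset.range (L / 2 + 1), ((j : ℝ) + 4)⁻¹ ≤ ∑ k ∈ Finset.range (L + 1), f k := by
    intro g hg hgr
    have hinj : Set.InjOn g (Finset.range (L / 2 + 1)) := by
      intro a ha b hb hab
      have ha' := hgr a (Nat.lt_succ_iff.1 (Finset.mem_range.1 ha))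
      have hb' := hgr b (Nat.lt_succ_iff.1 (Finset.mem_range.1 hb))
      rw [hab, hb'] at ha'
      exact_mod_cast ha'.symm
    calc ∑ j ∈ Finset.range (L / 2 + 1), ((j : ℝ) + 4)⁻¹
        ≤ ∑ j ∈ Finset.range (L / 2 + 1), f (g j) := by
          refine Finset.sum_le_sum fun j hj => ?_
          have := hf (g j)
          rwa [hgr j (Nat.lt_succ_iff.1 (Finset.mem_range.1 hj))] at this
      _ = ∑ k ∈ (Finset.range (L / 2 + 1)).image g, f k := (Finset.sum_image hinj).symm
      _ ≤ _ := by
          refine Finset.sum_le_sum_of_subset_of_nonneg ?_ fun _ _ _ => hf0 _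
          intro k hk
          obtain ⟨j, hj, rfl⟩ := Finset.mem_image.1 hk
          exact Finset.mem_range.2 (Nat.lt_succ_iff.2
            (hg j (Nat.lt_succ_iff.1 (Finset.mem_range.1 hj))))
  rcases le_total (L / 2) r with h | h
  · refine key (fun j => r - j) (fun j _ => by omega) fun j hj => ?_
    rw [Nat.cast_sub (hj.trans h)]
    simp
  · refine key (fun j => r + j) (fun j _ => by omega) fun j _ => ?_
    simp

lemma sum_inv_le_sum_pot (hd : 3 ≤ d) {L : ℕ} {z : ℤ × ℤ} {x : Zd d} (hx : x ∈ hook L z) :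
    ∑ j ∈ Finset.range (L / 2 + 1), ((j : ℝ) + 4)⁻¹ ≤ ∑ y ∈ hook L z, pot (x - y) := by
  have key : ∀ (g : ℕ → Zd d) (i : Fin d), (∀ a b, g a i - g b i = a - b) →
      (∀ a b, ∀ j ≠ i, g a j = g b j) → (∀ k ≤ L, g k ∈ hook L z) → ∀ r ≤ L,
      ∑ j ∈ Finset.range (L / 2 + 1), ((j : ℝ) + 4)⁻¹ ≤ ∑ y ∈ hook L z, pot (g r - y) := by
    intro g i hg hg' hgz r hr
    have hinj : Function.Injective g := by
      intro a b hab
      have := hg a b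
      rw [hab, sub_self] at this
      omega
    calc _ ≤ ∑ k ∈ Finset.range (L + 1), pot (g r - g k) := by
          refine sum_inv_le_sum hr (fun k => (pot_pos _).le) fun k => ?_
          refine inv_le_pot i (fun j hj => ?_) ?_
          · simp [hg' r k j hj]
          · rw [Pi.sub_apply, hg]
            push_cast
            exact le_rfl
      _ = ∑ y ∈ (Finset.range (L + 1)).image g, pot (g r - y) :=
          (Finset.sum_image (f := fun y => pot (g r - y)) hinj.injOn).symm
      _ ≤ _ := by
          refine Finset.sum_le_sum_of_subset_of_nonneg ?_ fun _ _ _ => (pot_pos _).le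
          intro y hy
          obtain ⟨k, hk, rfl⟩ := Finset.mem_image.1 hy
          exact hgz k (Nat.lt_succ_iff.1 (Finset.mem_range.1 hk))
  obtain ⟨r, hr, rfl | rfl⟩ := mem_hook.1 hx
  · refine key (fun r => planePt (L * z.1 + r, L * z.2)) ⟨0, by omega⟩ (fun a b => ?_)
      (fun a b j hj => ?_) (fun k hk => mem_hook.2 ⟨k, hk, Or.inl rfl⟩) r hr
    · simp [planePt]
    · have : (j : ℕ) ≠ 0 := fun h => hj (Fin.ext h)
      simp [planePt, this]
  · refine key (fun r => planePt (L * z.1, L * z.2 + r)) ⟨1, by omega⟩ (fun a b => ?_)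
      (fun a b j hj => ?_) (fun k hk => mem_hook.2 ⟨k, hk, Or.inr rfl⟩) r hr
    · simp [planePt]
    · have : (j : ℕ) ≠ 1 := fun h => hj (Fin.ext h)
      simp [planePt, this]

/-- The sup-norm distance on `ℤ²`. -/
def boxDist (z w : ℤ × ℤ) : ℕ := max (z.1 - w.1).natAbs (z.2 - w.2).natAbs

lemma pot_sub_le_of_mem_hook (hd : 3 ≤ d) {L : ℕ} (hL : 0 < L) {z w : ℤ × ℤ}
    (hzw : 2 ≤ boxDist z w) {x y : Zd d} (hx : x ∈ hook L z) (hy : y ∈ hook L w) :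
    pot (x - y) ≤ (L * ((boxDist z w : ℝ) - 1))⁻¹ := by
  have hcoord : ∀ (v : ℤ × ℤ) (a : Zd d), a ∈ hook L v →
      (L * v.1 ≤ a ⟨0, by omega⟩ ∧ a ⟨0, by omega⟩ ≤ L * v.1 + L) ∧
      (L * v.2 ≤ a ⟨1, by omega⟩ ∧ a ⟨1, by omega⟩ ≤ L * v.2 + L) := by
    intro v a ha
    obtain ⟨r, hr, rfl | rfl⟩ := mem_hook.1 ha <;> simp [planePt, hr]
  have hfar : ∀ s t a b : ℤ, L * s ≤ a → a ≤ L * s + L → L * t ≤ b → b ≤ L * t + L →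
      (boxDist z w = (s - t).natAbs) →
      (L * ((boxDist z w : ℝ) - 1)) ≤ |((a - b : ℤ) : ℝ)| := by
    intro s t a b h1 h2 h3 h4 h
    have h5 : (L : ℤ) * ((boxDist z w : ℤ) - 1) ≤ |a - b| := by
      rw [h, Int.natCast_natAbs]
      rcases abs_cases (s - t) with ⟨hs, _⟩ | ⟨hs, _⟩ <;> rw [hs]
      · exact le_trans (by linarith) (le_abs_self _)
      · exact le_trans (by linarith) (neg_le_abs _)
    exact_mod_cast h5
  have hpos : (0 : ℝ) < L * ((boxDist z w : ℝ) - 1) := by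
    have : (2 : ℝ) ≤ boxDist z w := by exact_mod_cast hzw
    have : (0 : ℝ) < L := by exact_mod_cast hL
    nlinarith
  obtain ⟨⟨hx1, hx2⟩, hx3, hx4⟩ := hcoord z x hx
  obtain ⟨⟨hy1, hy2⟩, hy3, hy4⟩ := hcoord w y hy
  rcases le_total (z.1 - w.1).natAbs (z.2 - w.2).natAbs with h | h
  · exact pot_le_inv ⟨1, by omega⟩ hpos (hfar z.2 w.2 _ _ hx3 hx4 hy3 hy4 (max_eq_right h))
  · exact pot_le_inv ⟨0, by omega⟩ hpos (hfar z.1 w.1 _ _ hx1 hx2 hy1 hy2 (max_eq_left h))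

/-- A set of points of `ℤ²` whose points hardly see each other. -/
def Sparse (T : Finset (ℤ × ℤ)) (c : ℝ) : Prop :=
  ∀ i ∈ T, (∀ j ∈ T, j ≠ i → 2 ≤ boxDist i j) ∧
    ∑ j ∈ T.erase i, ((boxDist i j : ℝ) - 1)⁻¹ ≤ c

lemma exists_le_sum_range_inv (C : ℝ) :
    ∃ L : ℕ, 0 < L ∧ C ≤ ∑ j ∈ Finset.range (L / 2 + 1), ((j : ℝ) + 4)⁻¹ := by
  have h := Real.tendsto_sum_range_one_div_nat_succ_atTop
  obtain ⟨n, hn⟩ := (h.eventually_ge_atTop (4 * C)).exists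
  refine ⟨2 * n + 2, by omega, ?_⟩
  rw [show (2 * n + 2) / 2 + 1 = n + 2 by omega]
  have h1 : ∑ j ∈ Finset.range n, (1 / ((j : ℝ) + 1)) ≤
      4 * ∑ j ∈ Finset.range n, ((j : ℝ) + 4)⁻¹ := by
    rw [Finset.mul_sum]
    refine Finset.sum_le_sum fun j _ => ?_
    rw [← div_eq_mul_inv, div_le_div_iff₀ (by positivity) (by positivity)]
    have : (0 : ℝ) ≤ j := Nat.cast_nonneg j
    linarith
  have h2 : ∑ j ∈ Finset.range n, ((j : ℝ) + 4)⁻¹ ≤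
      ∑ j ∈ Finset.range (n + 2), ((j : ℝ) + 4)⁻¹ :=
    Finset.sum_le_sum_of_subset_of_nonneg (Finset.range_mono (by omega))
      fun _ _ _ => by positivity
  linarith

/-- For a suitable mesh size and a small level, the hooks based at a sparse set of points all meet
the interlacement set with exponentially small probability. -/
theorem exists_forall_sparse_measure_le (hd : 3 ≤ d) {r : ℝ} (hr : 1 ≤ r) :
    ∃ L : ℕ, 0 < L ∧ ∃ u : ℝ, 0 < u ∧
      ∀ (P : Zd d → Measure (ℕ → Zd d)), IsSRW d P →
        ∀ Q : Measure (Zd d → Bool), IsVacantLaw P u Q → ∀ T : Finset (ℤ × ℤ), Sparse T 1 →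
          Q {Y | ∀ z ∈ T, ∃ x ∈ hook L z, Y x = false} ≤
            ENNReal.ofReal ((Real.exp 1 / r) ^ T.card) := by
  obtain ⟨L, hL, hS⟩ := exists_le_sum_range_inv (8 * r)
  set S := ∑ j ∈ Finset.range (L / 2 + 1), ((j : ℝ) + 4)⁻¹
  have hS0 : 0 < S := by linarith
  have hL0 : (1 : ℝ) ≤ L := by exact_mod_cast hL
  refine ⟨L, hL, ((2 * (L + 1) : ℕ) * (2 * r))⁻¹, by positivity, fun P hP Q hQ T hT => ?_⟩
  set h : ℤ × ℤ → Zd d → ENNReal := fun j x =>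
    (ENNReal.ofReal S)⁻¹ * ∑ y ∈ hook L j, ENNReal.ofReal (pot (x - y)) with hh
  have hh' : ∀ j x, h j x = ENNReal.ofReal (S⁻¹ * ∑ y ∈ hook L j, pot (x - y)) := by
    intro j x
    rw [ENNReal.ofReal_mul (by positivity), ENNReal.ofReal_inv_of_pos hS0,
      ENNReal.ofReal_sum_of_nonneg fun _ _ => (pot_pos _).le]
  refine hQ.measure_forall_exists_false_le (h := h) (p := 4 / S) (N := 2 * (L + 1)) hd hP
    (by positivity) hr (by positivity) ?_ (fun j x => ?_) (fun j x hx => ?_) (fun i hi x hx => ?_)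
    (fun i _ => card_hook_le L i) (inv_mul_cancel₀ (by positivity)).le
  · rw [← mul_div_assoc, div_le_iff₀ hS0]
    linarith
  · simp only [hh]
    rw [avg_const_mul, avg_finset_sum]
    gcongr with y
    rw [avg_translate (fun z => ENNReal.ofReal (pot z))]
    exact avg_pot_le hd _
  · rw [hh', ← ENNReal.ofReal_one]
    refine ENNReal.ofReal_le_ofReal ?_
    rw [← div_eq_inv_mul, le_div_iff₀ hS0, one_mul]
    exact sum_inv_le_sum_pot hd hx
  · obtain ⟨hfar, hsum⟩ := hT i hi
    rw [Finset.sum_congr rfl fun j _ => hh' j x, ← ENNReal.ofReal_sum_of_nonneg fun j _ =>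
      mul_nonneg (by positivity) (Finset.sum_nonneg fun _ _ => (pot_pos _).le)]
    refine ENNReal.ofReal_le_ofReal ?_
    calc ∑ j ∈ T.erase i, S⁻¹ * ∑ y ∈ hook L j, pot (x - y)
        ≤ ∑ j ∈ T.erase i, 4 / S * ((boxDist i j : ℝ) - 1)⁻¹ := by
          refine Finset.sum_le_sum fun j hj => ?_
          obtain ⟨hji, hjT⟩ := Finset.mem_erase.1 hj
          have h2 := hfar j hjT hji
          have h2' : (0 : ℝ) < (boxDist i j : ℝ) - 1 := by
            have : (2 : ℝ) ≤ boxDist i j := by exact_mod_cast h2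
            linarith
          have h3 : ∑ y ∈ hook L j, pot (x - y) ≤
              (2 * (L + 1) : ℕ) * (L * ((boxDist i j : ℝ) - 1))⁻¹ := by
            refine (Finset.sum_le_card_nsmul _ _ _ fun y hy =>
              pot_sub_le_of_mem_hook hd hL h2 hx hy).trans ?_
            rw [nsmul_eq_mul]
            gcongr
            exact card_hook_le L j
          have h4 : ((2 * (L + 1) : ℕ) : ℝ) * (L * ((boxDist i j : ℝ) - 1))⁻¹ ≤
              4 * ((boxDist i j : ℝ) - 1)⁻¹ := by
            rw [mul_inv, ← mul_assoc]
            gcongr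
            rw [← div_eq_mul_inv, div_le_iff₀ (by linarith)]
            push_cast
            linarith
          calc S⁻¹ * ∑ y ∈ hook L j, pot (x - y) ≤ S⁻¹ * (4 * ((boxDist i j : ℝ) - 1)⁻¹) := by
                gcongr
                exact h3.trans h4
            _ = _ := by ring
      _ = 4 / S * ∑ j ∈ T.erase i, ((boxDist i j : ℝ) - 1)⁻¹ := (Finset.mul_sum _ _ _).symm
      _ ≤ 4 / S := mul_le_of_le_one_right (by positivity) hsum

end Hooks

section Trees

/-- `z` and `w` are joined by a path of `*`-neighbours in `A`. -/
def StarConn (A : Set (ℤ × ℤ)) : ℤ × ℤ → ℤ × ℤ → Prop :=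
  Relation.ReflTransGen fun z w => boxDist z w ≤ 1 ∧ z ∈ A ∧ w ∈ A

lemma boxDist_comm (z w : ℤ × ℤ) : boxDist z w = boxDist w z := by
  unfold boxDist
  omega

lemma boxDist_triangle (z w v : ℤ × ℤ) : boxDist z v ≤ boxDist z w + boxDist w v := by
  unfold boxDist
  omega

lemma StarConn.symm {A : Set (ℤ × ℤ)} {z w : ℤ × ℤ} (h : StarConn A z w) : StarConn A w z := by
  induction h with
  | refl => exact .refl
  | tail _ h ih => exact .head ⟨by rw [boxDist_comm]; exact h.1, h.2.2, h.2.1⟩ ih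

lemma StarConn.mem {A : Set (ℤ × ℤ)} {z w : ℤ × ℤ} (h : StarConn A z w) (hz : z ∈ A) : w ∈ A := by
  induction h with
  | refl => exact hz
  | tail _ h _ => exact h.2.2

lemma StarConn.exists_boxDist_eq {A : Set (ℤ × ℤ)} {a y x : ℤ × ℤ} {k : ℕ}
    (h : StarConn A a y) (ha : boxDist a x ≤ k) (hy : k ≤ boxDist y x) :
    ∃ c, StarConn A a c ∧ boxDist c x = k := by
  induction h with
  | refl => exact ⟨a, .refl, le_antisymm ha hy⟩
  | @tail b c hab hbc ih =>
    rcases le_or_gt k (boxDist b x) with hb | hb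
    · exact ih hb
    · have h1 := boxDist_triangle c b x
      have h2 := boxDist_comm b c
      have h3 := hbc.1
      exact ⟨c, hab.tail hbc, by omega⟩

/-- The positions of a first child of a box of the next scale. -/
noncomputable def innerOffsets : Finset (ℤ × ℤ) := Finset.Icc 0 15 ×ˢ Finset.Icc 0 15

/-- The positions of a second child of a box of the next scale. -/
noncomputable def outerOffsets : Finset (ℤ × ℤ) :=
  (Finset.Icc (-32) 32 ×ˢ Finset.Icc (-32) 32).filter fun v => boxDist v 0 = 32

/-- The sets of leaves of the embedded binary trees of depth `n` rooted at `x`. -/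
noncomputable def leafSets : ℕ → ℤ × ℤ → Finset (Finset (ℤ × ℤ))
  | 0, x => {{x}}
  | n + 1, x => (innerOffsets ×ˢ outerOffsets).biUnion fun v =>
      Finset.image₂ (· ∪ ·) (leafSets n (x + (16 ^ n * v.1.1, 16 ^ n * v.1.2)))
        (leafSets n (x + (16 ^ n * v.2.1, 16 ^ n * v.2.2)))

lemma leafSets_zero (x : ℤ × ℤ) : leafSets 0 x = {{x}} := rfl

lemma leafSets_succ (n : ℕ) (x : ℤ × ℤ) : leafSets (n + 1) x =
    (innerOffsets ×ˢ outerOffsets).biUnion fun v =>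
      Finset.image₂ (· ∪ ·) (leafSets n (x + (16 ^ n * v.1.1, 16 ^ n * v.1.2)))
        (leafSets n (x + (16 ^ n * v.2.1, 16 ^ n * v.2.2))) := rfl

/-- An upper bound for the number of pairs of children. -/
def numChildren : ℕ := 256 * 4225

lemma card_product_offsets_le : (innerOffsets ×ˢ outerOffsets).card ≤ numChildren := by
  rw [Finset.card_product]
  refine Nat.mul_le_mul ?_ ((Finset.card_filter_le _ _).trans ?_)
  · simp [innerOffsets]
  · simp

lemma mem_innerOffsets {v : ℤ × ℤ} :
    v ∈ innerOffsets ↔ (0 ≤ v.1 ∧ v.1 ≤ 15) ∧ 0 ≤ v.2 ∧ v.2 ≤ 15 := by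
  simp only [innerOffsets, Finset.mem_product, Finset.mem_Icc]

lemma mem_outerOffsets {v : ℤ × ℤ} : v ∈ outerOffsets ↔ boxDist v 0 = 32 := by
  simp only [outerOffsets, Finset.mem_filter, Finset.mem_product, Finset.mem_Icc,
    and_iff_right_iff_imp, boxDist, Prod.fst_zero, Prod.snd_zero, sub_zero]
  intro h
  omega

attribute [irreducible] innerOffsets outerOffsets leafSets

lemma numChildren_mul_card_leafSets_le (n : ℕ) (x : ℤ × ℤ) :
    numChildren * (leafSets n x).card ≤ numChildren ^ 2 ^ n := by
  induction n generalizing x with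
  | zero => simp [leafSets_zero]
  | succ n ih =>
    have h2 : ∀ y z, numChildren * (numChildren *
        (Finset.image₂ (· ∪ ·) (leafSets n y) (leafSets n z)).card) ≤ numChildren ^ 2 ^ (n + 1) := by
      intro y z
      calc _ ≤ numChildren * (numChildren * ((leafSets n y).card * (leafSets n z).card)) := by
            gcongr
            exact Finset.card_image₂_le _ _ _
        _ = (numChildren * (leafSets n y).card) * (numChildren * (leafSets n z).card) := by ring
        _ ≤ numChildren ^ 2 ^ n * numChildren ^ 2 ^ n := Nat.mul_le_mul (ih y) (ih z)
        _ = numChildren ^ 2 ^ (n + 1) := by rw [← pow_add, pow_succ 2 n, mul_two]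
    have hpos : 0 < numChildren := by simp [numChildren]
    refine le_of_mul_le_mul_left ?_ hpos
    calc numChildren * (numChildren * (leafSets (n + 1) x).card)
        ≤ numChildren * (numChildren * ∑ v ∈ innerOffsets ×ˢ outerOffsets,
            (Finset.image₂ (· ∪ ·) (leafSets n (x + (16 ^ n * v.1.1, 16 ^ n * v.1.2)))
              (leafSets n (x + (16 ^ n * v.2.1, 16 ^ n * v.2.2)))).card) := by
          gcongr
          rw [leafSets_succ]
          exact Finset.card_biUnion_le
      _ = ∑ v ∈ innerOffsets ×ˢ outerOffsets, numChildren * (numChildren *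
            (Finset.image₂ (· ∪ ·) (leafSets n (x + (16 ^ n * v.1.1, 16 ^ n * v.1.2)))
              (leafSets n (x + (16 ^ n * v.2.1, 16 ^ n * v.2.2)))).card) := by
          rw [Finset.mul_sum, Finset.mul_sum]
      _ ≤ (innerOffsets ×ˢ outerOffsets).card • numChildren ^ 2 ^ (n + 1) :=
          Finset.sum_le_card_nsmul _ _ _ fun v _ => h2 _ _
      _ ≤ numChildren * numChildren ^ 2 ^ (n + 1) := by
          rw [smul_eq_mul]
          gcongr
          exact card_product_offsets_le

lemma mem_leafSets_succ {n : ℕ} {x : ℤ × ℤ} {T : Finset (ℤ × ℤ)} (hT : T ∈ leafSets (n + 1) x) :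
    ∃ y z, (0 ≤ y.1 - x.1 ∧ y.1 - x.1 ≤ 15 * 16 ^ n ∧ 0 ≤ y.2 - x.2 ∧ y.2 - x.2 ≤ 15 * 16 ^ n) ∧
      boxDist z x = 32 * 16 ^ n ∧
      ∃ T₁ ∈ leafSets n y, ∃ T₂ ∈ leafSets n z, T = T₁ ∪ T₂ := by
  rw [leafSets_succ] at hT
  obtain ⟨⟨v, w⟩, hvw, hT⟩ := Finset.mem_biUnion.1 hT
  obtain ⟨T₁, hT₁, T₂, hT₂, rfl⟩ := Finset.mem_image₂.1 hT
  rw [Finset.mem_product, mem_innerOffsets, mem_outerOffsets] at hvw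
  obtain ⟨⟨⟨h1, h2⟩, h3, h4⟩, h5⟩ := hvw
  have hpos : (0 : ℤ) < 16 ^ n := by positivity
  refine ⟨_, _, ?_, ?_, T₁, hT₁, T₂, hT₂, rfl⟩
  · simp only [Prod.fst_add, Prod.snd_add, add_sub_cancel_left]
    refine ⟨by positivity, by nlinarith, by positivity, by nlinarith⟩
  · simp only [boxDist, Prod.fst_add, Prod.snd_add, add_sub_cancel_left, Int.natAbs_mul,
      Int.natAbs_pow, Prod.fst_zero, Prod.snd_zero, sub_zero] at h5 ⊢
    rw [Nat.mul_max_mul_left, h5]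
    norm_num [mul_comm]

lemma boxDist_le_of_mem_leafSets {n : ℕ} {x : ℤ × ℤ} {T : Finset (ℤ × ℤ)}
    (hT : T ∈ leafSets n x) {z : ℤ × ℤ} (hz : z ∈ T) : boxDist z x ≤ 3 * 16 ^ n := by
  induction n generalizing x T z with
  | zero =>
    rw [leafSets_zero, Finset.mem_singleton] at hT
    subst hT
    rw [Finset.mem_singleton.1 hz]
    simp [boxDist]
  | succ n ih =>
    obtain ⟨y, w, ⟨h1, h2, h3, h4⟩, h5, T₁, hT₁, T₂, hT₂, rfl⟩ := mem_leafSets_succ hT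
    have hR : (16 : ℤ) ^ n = ((16 ^ n : ℕ) : ℤ) := by norm_cast
    rw [hR] at h2 h4
    rw [pow_succ]
    rcases Finset.mem_union.1 hz with h | h
    · have := ih hT₁ h
      unfold boxDist at *
      omega
    · have := ih hT₂ h
      unfold boxDist at *
      omega

lemma le_boxDist_of_mem_leafSets {n : ℕ} {x y w : ℤ × ℤ}
    (hy : 0 ≤ y.1 - x.1 ∧ y.1 - x.1 ≤ 15 * 16 ^ n ∧ 0 ≤ y.2 - x.2 ∧ y.2 - x.2 ≤ 15 * 16 ^ n)
    (hw : boxDist w x = 32 * 16 ^ n) {T₁ T₂ : Finset (ℤ × ℤ)} (hT₁ : T₁ ∈ leafSets n y)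
    (hT₂ : T₂ ∈ leafSets n w) {i j : ℤ × ℤ} (hi : i ∈ T₁) (hj : j ∈ T₂) :
    11 * 16 ^ n ≤ boxDist i j := by
  have h1 := boxDist_le_of_mem_leafSets hT₁ hi
  have h2 := boxDist_le_of_mem_leafSets hT₂ hj
  have hR : (16 : ℤ) ^ n = ((16 ^ n : ℕ) : ℤ) := by norm_cast
  rw [hR] at hy
  have h3 : 17 * 16 ^ n ≤ boxDist y w := by
    unfold boxDist at hw ⊢
    omega
  have h4 := boxDist_triangle y i w
  have h5 := boxDist_triangle i j w
  rw [boxDist_comm y i] at h4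
  omega

lemma sum_inv_boxDist_le {T : Finset (ℤ × ℤ)} {i : ℤ × ℤ} {n : ℕ} (hcard : T.card = 2 ^ n)
    (h : ∀ j ∈ T, 11 * 16 ^ n ≤ boxDist i j) :
    ∑ j ∈ T, ((boxDist i j : ℝ) - 1)⁻¹ ≤ (1 / 2) ^ (n + 1) := by
  have hone : (1 : ℝ) ≤ 8 ^ n := one_le_pow₀ (by norm_num)
  have h16 : (16 : ℝ) ^ n = 2 ^ n * 8 ^ n := by rw [← mul_pow]; norm_num
  have h4 : (8 : ℝ) ^ n = 2 ^ n * 4 ^ n := by rw [← mul_pow]; norm_num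
  have h4' : (1 : ℝ) ≤ 4 ^ n := one_le_pow₀ (by norm_num)
  have h2' : (1 : ℝ) ≤ 2 ^ n := one_le_pow₀ (by norm_num)
  calc ∑ j ∈ T, ((boxDist i j : ℝ) - 1)⁻¹ ≤ T.card • (10 * 16 ^ n : ℝ)⁻¹ := by
        refine Finset.sum_le_card_nsmul _ _ _ fun j hj => ?_
        have h1 : (11 * 16 ^ n : ℝ) ≤ boxDist i j := by exact_mod_cast h j hj
        gcongr
        have : (1 : ℝ) ≤ 16 ^ n := one_le_pow₀ (by norm_num)
        linarith
    _ = 2 ^ n / (10 * 16 ^ n) := by rw [hcard, nsmul_eq_mul]; push_cast; rfl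
    _ ≤ 1 / 2 ^ (n + 1) := by
        rw [div_le_div_iff₀ (by positivity) (by positivity), h16, h4, pow_succ]
        nlinarith [mul_le_mul h2' h2' zero_le_one (by positivity)]
    _ = (1 / 2) ^ (n + 1) := by rw [one_div_pow]

theorem card_and_sparse_of_mem_leafSets {n : ℕ} {x : ℤ × ℤ} {T : Finset (ℤ × ℤ)}
    (hT : T ∈ leafSets n x) : T.card = 2 ^ n ∧ Sparse T (1 - (1 / 2) ^ n) := by
  induction n generalizing x T with
  | zero =>
    rw [leafSets_zero, Finset.mem_singleton] at hT
    subst hT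
    refine ⟨by simp, fun i hi => ?_⟩
    rw [Finset.mem_singleton] at hi
    subst hi
    simp
  | succ n ih =>
    obtain ⟨y, w, hy, hw, T₁, hT₁, T₂, hT₂, rfl⟩ := mem_leafSets_succ hT
    obtain ⟨hc₁, hs₁⟩ := ih hT₁
    obtain ⟨hc₂, hs₂⟩ := ih hT₂
    have hpos : 0 < 16 ^ n := by positivity
    have hfar : ∀ i ∈ T₁, ∀ j ∈ T₂, 11 * 16 ^ n ≤ boxDist i j := fun i hi j hj =>
      le_boxDist_of_mem_leafSets hy hw hT₁ hT₂ hi hj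
    have hfar' : ∀ i ∈ T₂, ∀ j ∈ T₁, 11 * 16 ^ n ≤ boxDist i j := fun i hi j hj => by
      rw [boxDist_comm]
      exact hfar j hj i hi
    have hdisj : Disjoint T₁ T₂ := by
      rw [Finset.disjoint_left]
      intro i hi hi'
      have := hfar i hi i hi'
      simp only [boxDist, sub_self, Int.natAbs_zero, max_self] at this
      omega
    have hsparse : ∀ U V : Finset (ℤ × ℤ), Disjoint U V → Sparse U (1 - (1 / 2) ^ n) →
        V.card = 2 ^ n → (∀ i ∈ U, ∀ j ∈ V, 11 * 16 ^ n ≤ boxDist i j) → ∀ i ∈ U,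
        (∀ j ∈ U ∪ V, j ≠ i → 2 ≤ boxDist i j) ∧
          ∑ j ∈ (U ∪ V).erase i, ((boxDist i j : ℝ) - 1)⁻¹ ≤ 1 - (1 / 2) ^ (n + 1) := by
      intro U V hUV hU hV hfar i hi
      refine ⟨fun j hj hji => ?_, ?_⟩
      · rcases Finset.mem_union.1 hj with hj | hj
        · exact (hU i hi).1 j hj hji
        · have := hfar i hi j hj
          omega
      · rw [Finset.erase_union_distrib, Finset.erase_eq_of_notMem (s := V)
          (Finset.disjoint_left.1 hUV hi),
          Finset.sum_union (hUV.mono_left (Finset.erase_subset _ _))]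
        have h1 := (hU i hi).2
        have h2 := sum_inv_boxDist_le hV (hfar i hi)
        have h3 : ((1 : ℝ) / 2) ^ (n + 1) = (1 / 2) ^ n / 2 := by rw [pow_succ]; ring
        linarith
    refine ⟨by rw [Finset.card_union_of_disjoint hdisj, hc₁, hc₂, pow_succ, mul_two],
      fun i hi => ?_⟩
    rcases Finset.mem_union.1 hi with hi | hi
    · exact hsparse T₁ T₂ hdisj hs₁ hc₂ hfar i hi
    · rw [Finset.union_comm]
      exact hsparse T₂ T₁ hdisj.symm hs₂ hc₁ hfar' i hi

/-- A long `*`-path contains the leaves of an embedded tree. -/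
theorem exists_leafSet_subset {A : Set (ℤ × ℤ)} {n : ℕ} {x a y : ℤ × ℤ} (ha : a ∈ A)
    (hx : 0 ≤ a.1 - x.1 ∧ a.1 - x.1 < 16 ^ n ∧ 0 ≤ a.2 - x.2 ∧ a.2 - x.2 < 16 ^ n)
    (hy : 2 * 16 ^ n ≤ boxDist y x) (hay : StarConn A a y) :
    ∃ T ∈ leafSets n x, ↑T ⊆ A := by
  induction n generalizing x a y with
  | zero =>
    refine ⟨{x}, by simp [leafSets_zero], ?_⟩
    have : a = x := by
      ext <;> omega
    simpa [← this] using ha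
  | succ n ih =>
    have hpos : (0 : ℤ) < 16 ^ n := by positivity
    have hR : (16 : ℤ) ^ n = ((16 ^ n : ℕ) : ℤ) := by norm_cast
    have hdiv : ∀ t : ℤ, 0 ≤ t - 16 ^ n * (t / 16 ^ n) ∧ t - 16 ^ n * (t / 16 ^ n) < 16 ^ n := by
      intro t
      have h1 := Int.mul_ediv_add_emod t (16 ^ n)
      have h2 := Int.emod_nonneg t hpos.ne'
      have h3 := Int.emod_lt_of_pos t hpos
      omega
    have hle : ∀ t k : ℤ, 0 ≤ t → t < 16 ^ n * k → 0 ≤ t / 16 ^ n ∧ t / 16 ^ n < k :=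
      fun t k h1 h2 => ⟨Int.ediv_nonneg h1 hpos.le, Int.ediv_lt_of_lt_mul hpos (by linarith)⟩
    rw [pow_succ] at hx hy
    obtain ⟨c, hac, hc⟩ := hay.exists_boxDist_eq (x := x) (k := 2 * (16 ^ n * 16))
      (by unfold boxDist; omega) hy
    set v : ℤ × ℤ := ((a.1 - x.1) / 16 ^ n, (a.2 - x.2) / 16 ^ n) with hv
    set w : ℤ × ℤ := ((c.1 - x.1) / 16 ^ n, (c.2 - x.2) / 16 ^ n) with hw
    have ha1 := hdiv (a.1 - x.1)
    have ha2 := hdiv (a.2 - x.2)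
    have hc1 := hdiv (c.1 - x.1)
    have hc2 := hdiv (c.2 - x.2)
    have hvm : v ∈ innerOffsets := by
      have h1 := hle (a.1 - x.1) 16 hx.1 hx.2.1
      have h2 := hle (a.2 - x.2) 16 hx.2.2.1 hx.2.2.2
      rw [mem_innerOffsets]
      simp only [hv]
      omega
    have hbd : ∀ t : ℤ, t.natAbs ≤ 32 * 16 ^ n → (t / 16 ^ n).natAbs ≤ 32 := by
      intro t ht
      have h1 : -32 ≤ t / 16 ^ n := by
        rw [Int.le_ediv_iff_mul_le hpos]
        omega
      have h2 : t / 16 ^ n < 33 := Int.ediv_lt_of_lt_mul hpos (by omega)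
      omega
    have heq : ∀ t : ℤ, t.natAbs = 32 * 16 ^ n → (t / 16 ^ n).natAbs = 32 := by
      intro t ht
      have h1 : t = 32 * 16 ^ n ∨ t = (-32) * 16 ^ n := by omega
      rcases h1 with rfl | rfl <;> rw [Int.mul_ediv_cancel _ hpos.ne'] <;> rfl
    have hwm : w ∈ outerOffsets := by
      have h1 := hbd (c.1 - x.1) (by unfold boxDist at hc; omega)
      have h2 := hbd (c.2 - x.2) (by unfold boxDist at hc; omega)
      have h3 : (c.1 - x.1).natAbs = 32 * 16 ^ n ∨ (c.2 - x.2).natAbs = 32 * 16 ^ n := by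
        unfold boxDist at hc; omega
      simp only [mem_outerOffsets, boxDist, hw, Prod.fst_zero, Prod.snd_zero, sub_zero]
      rcases h3 with h3 | h3
      · have := heq _ h3; omega
      · have := heq _ h3; omega
    obtain ⟨T₁, hT₁, hT₁A⟩ := ih (x := x + (16 ^ n * v.1, 16 ^ n * v.2)) (a := a) (y := y) ha
      (by simp only [hv, Prod.fst_add, Prod.snd_add]; omega)
      (by simp only [hv, boxDist, Prod.fst_add, Prod.snd_add] at hy ⊢; omega) hay
    obtain ⟨T₂, hT₂, hT₂A⟩ := ih (x := x + (16 ^ n * w.1, 16 ^ n * w.2)) (a := c) (y := a)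
      (hac.mem ha) (by simp only [hw, Prod.fst_add, Prod.snd_add]; omega)
      (by simp only [hw, boxDist, Prod.fst_add, Prod.snd_add] at hc ⊢; omega) hac.symm
    rw [leafSets_succ]
    refine ⟨T₁ ∪ T₂, Finset.mem_biUnion.2 ⟨(v, w), Finset.mem_product.2 ⟨hvm, hwm⟩,
      Finset.mem_image₂.2 ⟨T₁, hT₁, T₂, hT₂, rfl⟩⟩, ?_⟩
    rw [Finset.coe_union]
    exact Set.union_subset hT₁A hT₂A

end Trees

section Duality

/-- `z` and `w` are nearest neighbours in `ℤ²`. -/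
def IsNbr (z w : ℤ × ℤ) : Prop := (z.1 - w.1).natAbs + (z.2 - w.2).natAbs = 1

/-- The indicator function of a subset of `ℤ²`, modulo `2`. -/
noncomputable def indicatorZMod (C : Set (ℤ × ℤ)) (z : ℤ × ℤ) : ZMod 2 :=
  open Classical in if z ∈ C then 1 else 0

/-- The indicator, modulo `2`, of the edges with one end in `C` and the other one in `G`. -/
noncomputable def edgeIndicator (C G : Set (ℤ × ℤ)) (z w : ℤ × ℤ) : ZMod 2 :=
  indicatorZMod C z * indicatorZMod G w + indicatorZMod C w * indicatorZMod G z

lemma indicatorZMod_of_mem {C : Set (ℤ × ℤ)} {z : ℤ × ℤ} (h : z ∈ C) : indicatorZMod C z = 1 :=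
  if_pos h

lemma indicatorZMod_of_notMem {C : Set (ℤ × ℤ)} {z : ℤ × ℤ} (h : z ∉ C) : indicatorZMod C z = 0 :=
  if_neg h

lemma edgeIndicator_of_notMem {C G : Set (ℤ × ℤ)} {z w : ℤ × ℤ} (hz : z ∉ C) (hw : w ∉ C) :
    edgeIndicator C G z w = 0 := by
  simp [edgeIndicator, indicatorZMod_of_notMem hz, indicatorZMod_of_notMem hw]

lemma edgeIndicator_of_notMem_right {C G : Set (ℤ × ℤ)} {z w : ℤ × ℤ} (hz : z ∉ G) (hw : w ∉ G) :
    edgeIndicator C G z w = 0 := by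
  simp [edgeIndicator, indicatorZMod_of_notMem hz, indicatorZMod_of_notMem hw]

lemma square_identity (a b c d a' b' c' d' : ZMod 2) :
    a * a' = 0 → b * b' = 0 → c * c' = 0 → d * d' = 0 →
    ((a' ≠ 0 ∨ b' ≠ 0 ∨ c' ≠ 0 ∨ d' ≠ 0) →
      (a ≠ 0 ∨ c ≠ 0 → (b ≠ 0 ∨ b' ≠ 0) ∧ (d ≠ 0 ∨ d' ≠ 0)) ∧
      (b ≠ 0 ∨ d ≠ 0 → (a ≠ 0 ∨ a' ≠ 0) ∧ (c ≠ 0 ∨ c' ≠ 0))) →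
    a * b' + b * a' + (c * d' + d * c') = a * d' + d * a' + (b * c' + c * b') := by
  have hcases : ∀ t t' : ZMod 2, t * t' = 0 →
      (t = 0 ∧ t' = 0) ∨ (t = 1 ∧ t' = 0) ∨ (t = 0 ∧ t' = 1) := by decide
  have htwo : (1 : ZMod 2) + 1 = 0 := by decide
  intro ha hb hc hd
  rcases hcases _ _ ha with ⟨rfl, rfl⟩ | ⟨rfl, rfl⟩ | ⟨rfl, rfl⟩ <;>
  rcases hcases _ _ hb with ⟨rfl, rfl⟩ | ⟨rfl, rfl⟩ | ⟨rfl, rfl⟩ <;>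
  rcases hcases _ _ hc with ⟨rfl, rfl⟩ | ⟨rfl, rfl⟩ | ⟨rfl, rfl⟩ <;>
  rcases hcases _ _ hd with ⟨rfl, rfl⟩ | ⟨rfl, rfl⟩ | ⟨rfl, rfl⟩ <;>
  simp [htwo]

lemma edgeIndicator_square {C G : Set (ℤ × ℤ)} (hCG : Disjoint C G)
    (h : ∀ z ∈ C, ∀ w, IsNbr z w → (∃ v ∈ G, boxDist v w ≤ 1) → w ∈ C ∨ w ∈ G) (x y : ℤ) :
    edgeIndicator C G (x, y) (x + 1, y) + edgeIndicator C G (x, y + 1) (x + 1, y + 1) =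
      edgeIndicator C G (x, y) (x, y + 1) + edgeIndicator C G (x + 1, y) (x + 1, y + 1) := by
  have hmem : ∀ (D : Set (ℤ × ℤ)) z, indicatorZMod D z ≠ 0 ↔ z ∈ D := by
    intro D z
    by_cases hz : z ∈ D
    · simp [indicatorZMod_of_mem hz, hz]
    · simp [indicatorZMod_of_notMem hz, hz]
  have hmul : ∀ z, indicatorZMod C z * indicatorZMod G z = 0 := by
    intro z
    by_cases hz : z ∈ C
    · rw [indicatorZMod_of_notMem (Set.disjoint_left.1 hCG hz), mul_zero]
    · rw [indicatorZMod_of_notMem hz, zero_mul]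
  have key := square_identity (indicatorZMod C (x, y)) (indicatorZMod C (x + 1, y))
    (indicatorZMod C (x + 1, y + 1)) (indicatorZMod C (x, y + 1))
    (indicatorZMod G (x, y)) (indicatorZMod G (x + 1, y))
    (indicatorZMod G (x + 1, y + 1)) (indicatorZMod G (x, y + 1))
    (hmul _) (hmul _) (hmul _) (hmul _) ?_
  · simp only [edgeIndicator]
    linear_combination key
  · simp only [hmem]
    intro hG
    have hG' : ∀ w : ℤ × ℤ, (w.1 = x ∨ w.1 = x + 1) → (w.2 = y ∨ w.2 = y + 1) →
        ∃ v ∈ G, boxDist v w ≤ 1 := by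
      intro w h1 h2
      rcases hG with h | h | h | h <;> refine ⟨_, h, ?_⟩ <;> unfold boxDist <;> simp only <;> omega
    have hstep : ∀ z w : ℤ × ℤ, z ∈ C → IsNbr z w → (w.1 = x ∨ w.1 = x + 1) →
        (w.2 = y ∨ w.2 = y + 1) → w ∈ C ∨ w ∈ G := fun z w hz hzw h1 h2 =>
      h z hz w hzw (hG' w h1 h2)
    constructor
    · rintro (h | h) <;> constructor <;> refine hstep _ _ h ?_ ?_ ?_ <;>
        simp [IsNbr]
    · rintro (h | h) <;> constructor <;> refine hstep _ _ h ?_ ?_ ?_ <;>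
        simp [IsNbr]

/-- The two ends, on an axis, of the exterior boundary of a finite cluster are joined by
a `*`-path of the complement of the cluster. -/
theorem starConn_of_finite {A C : Set (ℤ × ℤ)} (hfin : C.Finite) (hCA : Disjoint C A)
    (hbdry : ∀ z ∈ C, ∀ w, IsNbr z w → w ∈ C ∨ w ∈ A)
    (hconn : ∀ z ∈ C, ∀ w ∈ C,
      Relation.ReflTransGen (fun a b => IsNbr a b ∧ a ∈ C ∧ b ∈ C) z w)
    {p q : ℤ} (hp : (p, 0) ∈ C) (hp' : ∀ k, p < k → (k, 0) ∉ C)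
    (hq : (q, 0) ∈ C) (hq' : ∀ k, k < q → (k, 0) ∉ C) :
    StarConn A (p + 1, 0) (q - 1, 0) := by
  have hpA : (p + 1, 0) ∈ A :=
    (hbdry _ hp (p + 1, 0) (by simp [IsNbr])).resolve_left (hp' _ (by omega))
  by_contra hcon
  set G : Set (ℤ × ℤ) := {z | StarConn A (p + 1, 0) z} with hG
  have hGA : G ⊆ A := fun z hz => StarConn.mem hz hpA
  have hCG : Disjoint C G := hCA.mono_right hGA
  have hsq := edgeIndicator_square hCG fun z hz w hzw ⟨v, hv, hvw⟩ =>
    (hbdry z hz w hzw).imp_right fun hw => Relation.ReflTransGen.tail hv ⟨hvw, hGA hv, hw⟩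
  obtain ⟨M, hM⟩ : ∃ M : ℤ, ∀ z ∈ C, |z.1| < M ∧ |z.2| < M := by
    obtain ⟨M₁, h₁⟩ := (hfin.image fun z => |z.1|).bddAbove
    obtain ⟨M₂, h₂⟩ := (hfin.image fun z => |z.2|).bddAbove
    refine ⟨max M₁ M₂ + 1, fun z hz => ⟨?_, ?_⟩⟩
    · have := h₁ (Set.mem_image_of_mem _ hz)
      omega
    · have := h₂ (Set.mem_image_of_mem _ hz)
      omega
  have hM1 : ∀ x y : ℤ, M ≤ |x| → (x, y) ∉ C := fun x y h hz => (hM _ hz).1.not_ge h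
  have hM2 : ∀ x y : ℤ, M ≤ y → (x, y) ∉ C := fun x y h hz =>
    (hM _ hz).2.not_ge (h.trans (le_abs_self _))
  set e := edgeIndicator C G with he
  set φ : ℤ → ℤ → ZMod 2 := fun x y => ∑ j ∈ Finset.Ico y M, e (x, j) (x, j + 1) with hφ
  have hvert : ∀ x y, φ x y = e (x, y) (x, y + 1) + φ x (y + 1) := by
    intro x y
    rcases lt_or_ge y M with h | h
    · simp only [hφ]
      rw [← Finset.sum_insert (s := Finset.Ico (y + 1) M) (a := y)
        (f := fun j => e (x, j) (x, j + 1)) (by simp)]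
      congr 1
      ext j
      simp only [Finset.mem_Ico, Finset.mem_insert]
      omega
    · simp only [hφ]
      rw [Finset.Ico_eq_empty (by omega), Finset.Ico_eq_empty (by omega), he,
        edgeIndicator_of_notMem (hM2 _ _ h) (hM2 _ _ (by omega))]
      simp
  have htwo : ∀ t : ZMod 2, t + t = 0 := fun t => CharTwo.add_self_eq_zero t
  have hhor : ∀ x y, φ x y = e (x, y) (x + 1, y) + φ (x + 1) y := by
    intro x y
    rcases lt_or_ge y M with h | h
    · have haux : ∀ n : ℕ, φ x (M - n) = e (x, M - n) (x + 1, M - n) + φ (x + 1) (M - n) := by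
        intro n
        induction n with
        | zero =>
          simp only [hφ, Nat.cast_zero, sub_zero, Finset.Ico_self, Finset.sum_empty, add_zero]
          rw [he, edgeIndicator_of_notMem (hM2 _ _ le_rfl) (hM2 _ _ le_rfl)]
        | succ n ih =>
          have h1 := hvert x (M - (n + 1 : ℕ))
          have h2 := hvert (x + 1) (M - (n + 1 : ℕ))
          have h3 := hsq x (M - (n + 1 : ℕ))
          have h4 : M - (n + 1 : ℕ) + 1 = M - n := by push_cast; ring
          rw [h4] at h1 h2 h3
          rw [h1, h2, ih]
          linear_combination -h3 + htwo (e (x, M - n) (x + 1, M - n)) -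
            htwo (e (x + 1, M - (n + 1 : ℕ)) (x + 1, M - n))
      have := haux (M - y).toNat
      rwa [Int.toNat_of_nonneg (by omega), sub_sub_cancel] at this
    · simp only [hφ]
      rw [Finset.Ico_eq_empty (by omega), he,
        edgeIndicator_of_notMem (hM2 _ _ h) (hM2 _ _ h)]
      simp
  have hfar : ∀ x y, M ≤ |x| → φ x y = 0 := fun x y h =>
    Finset.sum_eq_zero fun j _ => edgeIndicator_of_notMem (hM1 _ _ h) (hM1 _ _ h)
  have hCe : ∀ z ∈ C, ∀ w ∈ C, e z w = 0 := fun z hz w hw =>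
    edgeIndicator_of_notMem_right (Set.disjoint_left.1 hCG hz) (Set.disjoint_left.1 hCG hw)
  have hCφ : ∀ z w : ℤ × ℤ, IsNbr z w → z ∈ C → w ∈ C → φ z.1 z.2 = φ w.1 w.2 := by
    rintro ⟨a, b⟩ ⟨a', b'⟩ hzw hz hw
    simp only [IsNbr] at hzw ⊢
    have hcases : (a' = a ∧ b' = b + 1) ∨ (a' = a ∧ b = b' + 1) ∨
        (b' = b ∧ a' = a + 1) ∨ (b' = b ∧ a = a' + 1) := by omega
    rcases hcases with ⟨rfl, rfl⟩ | ⟨rfl, rfl⟩ | ⟨rfl, rfl⟩ | ⟨rfl, rfl⟩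
    · rw [hvert, hCe _ hz _ hw, zero_add]
    · rw [hvert a' b', hCe _ hw _ hz, zero_add]
    · rw [hhor, hCe _ hz _ hw, zero_add]
    · rw [hhor a', hCe _ hw _ hz, zero_add]
  have hpq : φ p 0 = φ q 0 := by
    have := hconn _ hp _ hq
    have hgen : ∀ z, Relation.ReflTransGen (fun a b => IsNbr a b ∧ a ∈ C ∧ b ∈ C) (p, 0) z →
        φ p 0 = φ z.1 z.2 := by
      intro z hz
      induction hz with
      | refl => rfl
      | tail _ h ih => rw [ih, hCφ _ _ h.1 h.2.1 h.2.2]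
    exact hgen _ this
  have hright : φ (p + 1) 0 = 0 := by
    have haux : ∀ n : ℕ, φ (p + 1) 0 = φ (p + 1 + n) 0 := by
      intro n
      induction n with
      | zero => simp
      | succ n ih =>
        rw [ih, hhor, he, edgeIndicator_of_notMem (hp' _ (by omega)) (hp' _ (by omega)), zero_add]
        push_cast
        rw [add_assoc (p + 1)]
    rw [haux (M - p - 1).toNat]
    exact hfar _ _ (le_trans (by omega) (le_abs_self _))
  have hleft : φ (q - 1) 0 = 0 := by
    have haux : ∀ n : ℕ, φ (q - 1) 0 = φ (q - 1 - n) 0 := by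
      intro n
      induction n with
      | zero => simp
      | succ n ih =>
        rw [ih, hhor (q - 1 - (n + 1 : ℕ)), he,
          edgeIndicator_of_notMem (hq' _ (by omega)) (hq' _ (by omega)), zero_add]
        push_cast
        congr 1
        ring
    rw [haux (M + q).toNat]
    exact hfar _ _ (le_trans (by omega) (neg_le_abs _))
  have h1 : φ p 0 = 1 := by
    rw [hhor, hright, he, edgeIndicator, indicatorZMod_of_mem hp,
      indicatorZMod_of_mem (show (p + 1, (0 : ℤ)) ∈ G from Relation.ReflTransGen.refl),
      indicatorZMod_of_notMem (hp' (p + 1) (by omega))]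
    simp
  have h2 : φ q 0 = 0 := by
    have h3 := hhor (q - 1) 0
    rw [sub_add_cancel, hleft, he, edgeIndicator, indicatorZMod_of_mem hq,
      indicatorZMod_of_notMem (show (q - 1, (0 : ℤ)) ∉ G from hcon),
      indicatorZMod_of_notMem (hq' (q - 1) (by omega))] at h3
    simpa using h3.symm
  rw [h1, h2] at hpq
  exact one_ne_zero hpq

end Duality

section Percolation

/-- The sites of the coarse-grained plane whose hook meets the complement of the vacant set. -/
def closedSites (L : ℕ) (Y : Zd d → Bool) : Set (ℤ × ℤ) := {z | ∃ x ∈ hook L z, Y x = false}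

/-- The event that the origin is closed, or that some set of the families `leafSets` issued from
the positive half-axis is closed. -/
def blockingEvent (d L : ℕ) : Set (Zd d → Bool) :=
  {Y | 0 ∈ closedSites L Y} ∪ ⋃ n : ℕ, ⋃ m ∈ Finset.Ico 1 (2 * 16 ^ (n + 1)),
    ⋃ T ∈ leafSets n ((m : ℕ), 0), {Y | ∀ z ∈ T, z ∈ closedSites L Y}

lemma measure_iUnion_leafSets_le {Q : Measure (Zd d → Bool)} {L : ℕ}
    (hQ : ∀ T, Sparse T 1 → Q {Y | ∀ z ∈ T, z ∈ closedSites L Y} ≤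
      ENNReal.ofReal (((128 * numChildren : ℝ)⁻¹) ^ T.card)) (n : ℕ) :
    Q (⋃ m ∈ Finset.Ico 1 (2 * 16 ^ (n + 1)), ⋃ T ∈ leafSets n ((m : ℕ), 0),
      {Y | ∀ z ∈ T, z ∈ closedSites L Y}) ≤ ENNReal.ofReal (4⁻¹ * 8⁻¹ ^ n) := by
  set N : ℝ := (numChildren : ℝ) with hN
  have hN1 : 1 ≤ N := by rw [hN]; norm_num [numChildren]
  have hcard : ∀ m : ℕ, ((leafSets n (m, 0)).card : ℝ) ≤ N ^ 2 ^ n := by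
    intro m
    have h := numChildren_mul_card_leafSets_le n (m, 0)
    have h' : N * (leafSets n (m, 0)).card ≤ N ^ 2 ^ n := by rw [hN]; exact_mod_cast h
    nlinarith [Nat.cast_nonneg (α := ℝ) (leafSets n (m, 0)).card]
  have hpow : ((128 : ℝ)⁻¹) ^ 2 ^ n ≤ 128⁻¹ ^ (n + 1) :=
    pow_le_pow_of_le_one (by norm_num) (by norm_num) Nat.lt_two_pow_self
  have hsum : ∀ m : ℕ, Q (⋃ T ∈ leafSets n ((m : ℕ), 0), {Y | ∀ z ∈ T, z ∈ closedSites L Y}) ≤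
      ENNReal.ofReal (128⁻¹ ^ (n + 1)) := by
    intro m
    calc _ ≤ ∑ T ∈ leafSets n ((m : ℕ), 0), Q {Y | ∀ z ∈ T, z ∈ closedSites L Y} :=
          measure_biUnion_finset_le _ _
      _ ≤ ∑ T ∈ leafSets n ((m : ℕ), 0), ENNReal.ofReal ((128 * N)⁻¹ ^ 2 ^ n) := by
          refine Finset.sum_le_sum fun T hT => ?_
          obtain ⟨h1, h2⟩ := card_and_sparse_of_mem_leafSets hT
          rw [← h1]
          refine hQ T fun i hi => ⟨(h2 i hi).1, (h2 i hi).2.trans ?_⟩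
          linarith [show (0 : ℝ) ≤ (1 / 2) ^ n by positivity]
      _ = ENNReal.ofReal ((leafSets n ((m : ℕ), 0)).card * (128 * N)⁻¹ ^ 2 ^ n) := by
          rw [Finset.sum_const, nsmul_eq_mul, ENNReal.ofReal_mul (by positivity),
            ENNReal.ofReal_natCast]
      _ ≤ _ := by
          refine ENNReal.ofReal_le_ofReal (le_trans ?_ hpow)
          calc _ ≤ N ^ 2 ^ n * (128 * N)⁻¹ ^ 2 ^ n := by gcongr; exact hcard m
            _ = _ := by rw [← mul_pow]; congr 1; field_simp
  calc _ ≤ ∑ m ∈ Finset.Ico 1 (2 * 16 ^ (n + 1)),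
        Q (⋃ T ∈ leafSets n ((m : ℕ), 0), {Y | ∀ z ∈ T, z ∈ closedSites L Y}) :=
        measure_biUnion_finset_le _ _
    _ ≤ ∑ m ∈ Finset.Ico 1 (2 * 16 ^ (n + 1)), ENNReal.ofReal (128⁻¹ ^ (n + 1)) :=
        Finset.sum_le_sum fun m _ => hsum m
    _ = ENNReal.ofReal ((2 * 16 ^ (n + 1) - 1 : ℕ) * 128⁻¹ ^ (n + 1)) := by
        rw [Finset.sum_const, nsmul_eq_mul, Nat.card_Ico, ENNReal.ofReal_mul (by positivity),
          ENNReal.ofReal_natCast]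
    _ ≤ _ := by
        refine ENNReal.ofReal_le_ofReal ?_
        calc _ ≤ ((2 * 16 ^ (n + 1) : ℕ) : ℝ) * 128⁻¹ ^ (n + 1) := by
              gcongr
              exact Nat.sub_le _ _
          _ = 4⁻¹ * (16 * 128⁻¹) ^ n := by rw [mul_pow]; push_cast; ring
          _ = _ := by norm_num

lemma measure_blockingEvent_lt_one {Q : Measure (Zd d → Bool)} {L : ℕ}
    (hQ : ∀ T, Sparse T 1 → Q {Y | ∀ z ∈ T, z ∈ closedSites L Y} ≤
      ENNReal.ofReal (((128 * numChildren : ℝ)⁻¹) ^ T.card)) :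
    Q (blockingEvent d L) < 1 := by
  have h0 : Q {Y | 0 ∈ closedSites L Y} ≤ ENNReal.ofReal 128⁻¹ := by
    have h := hQ {0} (fun i hi => by
      obtain rfl := Finset.mem_singleton.1 hi
      simp)
    simp only [Finset.mem_singleton, forall_eq, Finset.card_singleton, pow_one] at h
    refine h.trans (ENNReal.ofReal_le_ofReal ?_)
    norm_num [numChildren]
  have hgeo : HasSum (fun n : ℕ => (4⁻¹ : ℝ) * 8⁻¹ ^ n) (4⁻¹ * (1 - 8⁻¹)⁻¹) :=
    (hasSum_geometric_of_lt_one (by norm_num) (by norm_num)).mul_left _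
  calc Q (blockingEvent d L)
      ≤ ENNReal.ofReal 128⁻¹ + ∑' n : ℕ, ENNReal.ofReal (4⁻¹ * 8⁻¹ ^ n) :=
        (measure_union_le _ _).trans (add_le_add h0 ((measure_iUnion_le _).trans
          (ENNReal.tsum_le_tsum fun n => measure_iUnion_leafSets_le hQ n)))
    _ = ENNReal.ofReal (128⁻¹ + 4⁻¹ * (1 - 8⁻¹)⁻¹) := by
        rw [← ENNReal.ofReal_tsum_of_nonneg (fun n => by positivity) hgeo.summable, hgeo.tsum_eq,
          ← ENNReal.ofReal_add (by norm_num) (by norm_num)]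
    _ < 1 := by
        rw [ENNReal.ofReal_lt_one]
        norm_num

/-- The nearest-neighbour cluster of the origin in the complement of `A`. -/
def planeCluster (A : Set (ℤ × ℤ)) : Set (ℤ × ℤ) :=
  {z | Relation.ReflTransGen (fun a b => IsNbr a b ∧ a ∉ A ∧ b ∉ A) 0 z}

lemma IsNbr.symm {z w : ℤ × ℤ} (h : IsNbr z w) : IsNbr w z := by
  unfold IsNbr at *
  omega

lemma infinite_planeCluster {L : ℕ} {Y : Zd d → Bool} (hY : Y ∉ blockingEvent d L) :
    (planeCluster (closedSites L Y)).Infinite := by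
  intro hfin
  set A := closedSites L Y with hA
  set C := planeCluster A with hC
  simp only [blockingEvent, Set.mem_union, Set.mem_iUnion, not_or, not_exists] at hY
  have h0A : (0 : ℤ × ℤ) ∉ A := hY.1
  have h0C : (0 : ℤ × ℤ) ∈ C := Relation.ReflTransGen.refl
  have hCA : ∀ z ∈ C, z ∉ A := by
    intro z hz
    induction hz with
    | refl => exact h0A
    | tail _ h => exact h.2.2
  have hconn0 : ∀ z ∈ C, Relation.ReflTransGen (fun a b => IsNbr a b ∧ a ∈ C ∧ b ∈ C) 0 z := by
    intro z hz
    induction hz with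
    | refl => exact .refl
    | tail hab h ih => exact ih.tail ⟨h.1, hab, hab.tail h⟩
  have hsymm : ∀ z w, Relation.ReflTransGen (fun a b => IsNbr a b ∧ a ∈ C ∧ b ∈ C) z w →
      Relation.ReflTransGen (fun a b => IsNbr a b ∧ a ∈ C ∧ b ∈ C) w z := fun z w h =>
    (@Relation.ReflTransGen.stdSymm _ _ ⟨fun _ _ h => ⟨h.1.symm, h.2.2, h.2.1⟩⟩).symm _ _ h
  have hfin' : {k : ℤ | (k, (0 : ℤ)) ∈ C}.Finite :=
    hfin.preimage fun a _ b _ h => (Prod.ext_iff.1 h).1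
  obtain ⟨p, hp, hpmax⟩ := hfin'.exists_maximal ⟨0, h0C⟩
  obtain ⟨q, hq, hqmin⟩ := hfin'.exists_minimal ⟨0, h0C⟩
  have hp' : ∀ k, p < k → (k, 0) ∉ C := fun k hk h => hk.not_ge (hpmax h hk.le)
  have hq' : ∀ k, k < q → (k, 0) ∉ C := fun k hk h => hk.not_ge (hqmin h hk.le)
  have hp0 : 0 ≤ p := not_lt.1 fun h => hp' 0 h h0C
  have hq0 : q ≤ 0 := not_lt.1 fun h => hq' 0 h h0C
  have hbdry : ∀ z ∈ C, ∀ w, IsNbr z w → w ∈ C ∨ w ∈ A := fun z hz w hzw =>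
    or_iff_not_imp_right.2 fun hw => Relation.ReflTransGen.tail hz ⟨hzw, hCA z hz, hw⟩
  have hstar := starConn_of_finite hfin (Set.disjoint_left.2 hCA) hbdry
    (fun z hz w hw => (hsymm _ _ (hconn0 z hz)).trans (hconn0 w hw)) hp hp' hq hq'
  obtain ⟨m, hm⟩ : ∃ m : ℕ, p + 1 = m := ⟨(p + 1).toNat, by omega⟩
  have hm1 : 1 ≤ m := by omega
  rw [hm] at hstar
  have hmA : ((m : ℤ), (0 : ℤ)) ∈ A := by
    rw [← hm]
    exact (hbdry _ hp _ (by simp [IsNbr])).resolve_left (hp' _ (by omega))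
  obtain ⟨n, hn⟩ : ∃ n, n = Nat.log 16 ((m + 1) / 2) := ⟨_, rfl⟩
  have hn1 : 16 ^ n ≤ (m + 1) / 2 := hn ▸ Nat.pow_log_le_self 16 (by omega)
  have hn2 : (m + 1) / 2 < 16 ^ (n + 1) := hn ▸ Nat.lt_pow_succ_log_self (by norm_num) _
  obtain ⟨T, hT, hTA⟩ := exists_leafSet_subset (n := n) (x := (m, 0)) hmA
    (by simp) (by simp only [boxDist]; omega) hstar
  exact hY.2 n m (Finset.mem_Ico.2 ⟨hm1, by omega⟩) T hT fun z hz => hTA hz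

lemma adj_planePt (hd : 3 ≤ d) {z w : ℤ × ℤ} (h : IsNbr z w) :
    adj (planePt z : Zd d) (planePt w) := by
  obtain ⟨e, rfl⟩ := Nat.exists_eq_add_of_le' (show 2 ≤ d by omega)
  unfold IsNbr at h
  simp only [adj, planePt, Fin.sum_univ_succ]
  simp [Int.abs_eq_natAbs, -Nat.cast_natAbs]
  omega

lemma planePt_injective (hd : 3 ≤ d) : Function.Injective (planePt : ℤ × ℤ → Zd d) := by
  intro z w h
  have h0 := congrFun h ⟨0, by omega⟩
  have h1 := congrFun h ⟨1, by omega⟩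
  simp only [planePt] at h0 h1
  exact Prod.ext (by simpa using h0) (by simpa using h1)

lemma adj.symm {x y : Zd d} (h : adj x y) : adj y x := by
  unfold adj at *
  simpa only [abs_sub_comm] using h

lemma reflTransGen_of_forall_le (hd : 3 ≤ d) {S : Set (Zd d)} {L : ℕ} {f : ℕ → ℤ × ℤ}
    (hf : ∀ k, IsNbr (f k) (f (k + 1))) (hS : ∀ k ≤ L, planePt (f k) ∈ S) :
    Relation.ReflTransGen (fun a b => adj a b ∧ a ∈ S ∧ b ∈ S) (planePt (f 0)) (planePt (f L)) := by
  have h : ∀ k ≤ L, Relation.ReflTransGen (fun a b => adj a b ∧ a ∈ S ∧ b ∈ S)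
      (planePt (f 0)) (planePt (f k)) := by
    intro k
    induction k with
    | zero => exact fun _ => .refl
    | succ k ih =>
      exact fun hk => (ih (by omega)).tail
        ⟨adj_planePt hd (hf k), hS k (by omega), hS _ hk⟩
  exact h L le_rfl

lemma infinite_component_of_infinite_planeCluster (hd : 3 ≤ d) {L : ℕ} (hL : 0 < L)
    {Y : Zd d → Bool} (h : (planeCluster (closedSites L Y)).Infinite) :
    (component {x : Zd d | Y x = true} 0).Infinite := by
  set S : Set (Zd d) := {x | Y x = true} with hS
  have hopen : ∀ z ∉ closedSites L Y, ∀ r ≤ L, planePt (L * z.1 + r, L * z.2) ∈ S ∧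
      planePt (L * z.1, L * z.2 + r) ∈ S := by
    intro z hz r hr
    have hvac : ∀ x ∈ hook L z, x ∈ S := fun x hx =>
      (Bool.eq_false_or_eq_true (Y x)).resolve_right fun h => hz ⟨x, hx, h⟩
    exact ⟨hvac _ (mem_hook.2 ⟨r, hr, Or.inl rfl⟩), hvac _ (mem_hook.2 ⟨r, hr, Or.inr rfl⟩)⟩
  have hright : ∀ a b : ℤ, (a, b) ∉ closedSites L Y →
      Relation.ReflTransGen (fun a b => adj a b ∧ a ∈ S ∧ b ∈ S)
        (planePt (L * a, L * b)) (planePt (L * (a + 1), L * b)) := by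
    intro a b hab
    have := reflTransGen_of_forall_le hd (S := S) (L := L) (f := fun r => (L * a + r, L * b))
      (fun k => by simp [IsNbr]) fun k hk => (hopen _ hab k hk).1
    simpa [mul_add] using this
  have hup : ∀ a b : ℤ, (a, b) ∉ closedSites L Y →
      Relation.ReflTransGen (fun a b => adj a b ∧ a ∈ S ∧ b ∈ S)
        (planePt (L * a, L * b)) (planePt (L * a, L * (b + 1))) := by
    intro a b hab
    have := reflTransGen_of_forall_le hd (S := S) (L := L) (f := fun r => (L * a, L * b + r))
      (fun k => by simp [IsNbr]) fun k hk => (hopen _ hab k hk).2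
    simpa [mul_add] using this
  have hsymm : ∀ x y, Relation.ReflTransGen (fun a b => adj a b ∧ a ∈ S ∧ b ∈ S) x y →
      Relation.ReflTransGen (fun a b => adj a b ∧ a ∈ S ∧ b ∈ S) y x := fun _ _ h =>
    (@Relation.ReflTransGen.stdSymm _ _ ⟨fun _ _ h => ⟨adj.symm h.1, h.2.2, h.2.1⟩⟩).symm _ _ h
  have hmem : ∀ z ∈ planeCluster (closedSites L Y),
      (planePt (L * z.1, L * z.2) : Zd d) ∈ component S 0 := by
    intro z hz
    induction hz with
    | refl =>
      have h0 : (planePt (L * (0 : ℤ × ℤ).1, L * (0 : ℤ × ℤ).2) : Zd d) = 0 := by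
        ext i
        simp [planePt]
      rw [h0]
      exact Relation.ReflTransGen.refl
    | @tail z w _ hzw ih =>
      refine Relation.ReflTransGen.trans ih ?_
      obtain ⟨hnbr, hz, hw⟩ := hzw
      obtain ⟨a, b⟩ := z
      obtain ⟨a', b'⟩ := w
      simp only [IsNbr] at hnbr
      have hcases : (a' = a ∧ b' = b + 1) ∨ (a' = a ∧ b = b' + 1) ∨
          (b' = b ∧ a' = a + 1) ∨ (b' = b ∧ a = a' + 1) := by omega
      rcases hcases with ⟨rfl, rfl⟩ | ⟨rfl, rfl⟩ | ⟨rfl, rfl⟩ | ⟨rfl, rfl⟩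
      exacts [hup _ _ hz, hsymm _ _ (hup _ _ hw), hright _ _ hz, hsymm _ _ (hright _ _ hw)]
  have hinj : Function.Injective fun z : ℤ × ℤ => (planePt (L * z.1, L * z.2) : Zd d) := by
    intro z w hzw
    have hL' : L ≠ 0 := hL.ne'
    have := planePt_injective hd hzw
    simpa [Prod.ext_iff, hL'] using this
  exact (h.image hinj.injOn).mono (Set.image_subset_iff.2 hmem)

lemma vacant_zero_of_notMem_blockingEvent {L : ℕ} {Y : Zd d → Bool}
    (hY : Y ∉ blockingEvent d L) : Y 0 = true := by
  refine (Bool.eq_false_or_eq_true (Y 0)).resolve_right fun h => hY (Or.inl ⟨0, ?_, h⟩)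
  refine mem_hook.2 ⟨0, Nat.zero_le _, Or.inl ?_⟩
  ext i
  simp [planePt]

end Percolation

end RI

open RI MeasureTheory Filter

/-- **Non-degeneracy of `u_*`: `u_* > 0` in all dimensions `d ≥ 3`.**
There exists `u > 0` such that, for every vacant-set law `Q` at level `u`, the
`Q`-probability that the origin belongs to an infinite nearest-neighbour connected
component of `{x ∈ ℤ^d : Y_x = 1}` is strictly positive. -/
theorem ustar_positive (d : ℕ) (hd : 3 ≤ d) :
    ∃ u : ℝ, 0 < u ∧
      ∀ (P : Zd d → Measure (ℕ → Zd d)), IsSRW d P →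
        ∀ Q : Measure (Zd d → Bool), IsVacantLaw P u Q →
          0 < Q {Y | Y 0 = true ∧
                (component {z : Zd d | Y z = true} (0 : Zd d)).Infinite} := by
  have hr : (1 : ℝ) ≤ Real.exp 1 * (128 * numChildren) := by
    have := Real.add_one_le_exp (1 : ℝ)
    norm_num [numChildren]
    linarith
  obtain ⟨L, hL, u, hu, H⟩ := exists_forall_sparse_measure_le hd hr
  refine ⟨u, hu, fun P hP Q hQ => ?_⟩
  have := hQ.1
  have hlt : Q (blockingEvent d L) < 1 := measure_blockingEvent_lt_one fun T hT => by
    have h := H P hP Q hQ T hT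
    rwa [div_mul_cancel_left₀ (Real.exp_ne_zero 1)] at h
  refine pos_iff_ne_zero.2 fun h0 => hlt.not_ge ?_
  rw [← measure_univ (μ := Q), ← zero_add (Q (blockingEvent d L)), ← h0]
  refine (measure_mono fun Y _ => ?_).trans (measure_union_le _ _)
  by_cases hY : Y ∈ blockingEvent d L
  · exact Or.inr hY
  · exact Or.inl ⟨vacant_zero_of_notMem_blockingEvent hY,
      infinite_component_of_infinite_planeCluster hd hL (infinite_planeCluster hY)⟩
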